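/- arXiv:2512.19411 — 2 statements merged into one kernel-verified Lean document; each statement's English description precedes it below -/
import Mathlib

section
/- There exists a constant d > 0 such that for every finite-dimensional complex Hilbert space H (with X = B(H)), every λ > 1, every 1 ≤ p < ∞, every 1 ≤ q ≤ ∞, every integer n ≥ 2, and every complex Banach space Z = (ℂ^n,‖·‖) whose canonical basis is 1-unconditional: AP_λ(B_Z,p,X) ≤ d · λ^{1/log n} · ‖Id : Z → ℓ^n_q‖ · (log n)^{1 − 1/min{2,q}} · n^{−(1/p + 1/max{2,q} − 1/2)}. -/
open scoped BigOperators ENNReal NNReal Pointwise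
open Finset

noncomputable section

namespace ArithBohr

/-- The monomial `z ^ α` on `ℂ^n`. -/
def mono {n : ℕ} (z : Fin n → ℂ) (α : Fin n → ℕ) : ℂ := ∏ i, z i ^ α i

/-- The real monomial `r ^ α`. -/
def monoR {n : ℕ} (r : Fin n → ℝ) (α : Fin n → ℕ) : ℝ := ∏ i, r i ^ α i

/-- `‖f‖_Ω = sup_{z ∈ Ω} ‖f z‖`. -/
def supNorm {n : ℕ} {E : Type*} [Norm E] (Ω : Set (Fin n → ℂ)) (f : (Fin n → ℂ) → E) : ℝ :=
  ⨆ z : Ω, ‖f z.1‖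

/-- `f` is bounded on `Ω`. -/
def IsBoundedOn {n : ℕ} {E : Type*} [Norm E] (Ω : Set (Fin n → ℂ)) (f : (Fin n → ℂ) → E) :
    Prop :=
  ∃ M : ℝ, ∀ z ∈ Ω, ‖f z‖ ≤ M

/-- A complete Reinhardt set in `ℂ^n`. -/
def IsCompleteReinhardt {n : ℕ} (Ω : Set (Fin n → ℂ)) : Prop :=
  ∀ z ∈ Ω, ∀ ξ : Fin n → ℂ, (∀ i, ‖ξ i‖ ≤ 1) → (fun i => ξ i * z i) ∈ Ω

/-- The `ℓ_q` norm on `ℂ^n`, `q ∈ [1,∞]` (as an extended real exponent). -/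
def lqNorm {n : ℕ} (q : ℝ≥0∞) (z : Fin n → ℂ) : ℝ :=
  if q = ∞ then ⨆ i, ‖z i‖ else (∑ i, ‖z i‖ ^ q.toReal) ^ (1 / q.toReal)

/-- The `ℓ_q` norm on `ℂ^n` for a real exponent `1 ≤ q < ∞`. -/
def lqNormR {n : ℕ} (q : ℝ) (z : Fin n → ℂ) : ℝ := (∑ i, ‖z i‖ ^ q) ^ (1 / q)

/-- The open unit ball of `ℓ^n_q`. -/
def lqBall (n : ℕ) (q : ℝ≥0∞) : Set (Fin n → ℂ) := {z | lqNorm q z < 1}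

/-- The open unit ball of `ℓ^n_q` for a real exponent. -/
def lqBallR (n : ℕ) (q : ℝ) : Set (Fin n → ℂ) := {z | lqNormR q z < 1}

/-- The open unit ball of `ℓ^n_1`. -/
def l1Ball (n : ℕ) : Set (Fin n → ℂ) := {z | ∑ i, ‖z i‖ < 1}

/-- `S(Ω₁, Ω₂) = inf {s > 0 : Ω₁ ⊆ s Ω₂}`. -/
def Sdist {n : ℕ} (Ω₁ Ω₂ : Set (Fin n → ℂ)) : ℝ := sInf {s : ℝ | 0 < s ∧ Ω₁ ⊆ s • Ω₂}

/-- A norm on `ℂ^n` for which the canonical basis is `1`-unconditional. -/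
structure UncondNorm (n : ℕ) where
  N : (Fin n → ℂ) → ℝ
  eq_zero_iff : ∀ z, N z = 0 ↔ z = 0
  add_le : ∀ z w, N (z + w) ≤ N z + N w
  smul_eq : ∀ (c : ℂ) (z), N (c • z) = ‖c‖ * N z
  uncond : ∀ ξ z : Fin n → ℂ, (∀ i, ‖ξ i‖ ≤ 1) → N (fun i => ξ i * z i) ≤ N z

namespace UncondNorm

variable {n : ℕ} (Z : UncondNorm n)

/-- The open unit ball `B_Z`. -/
def ball : Set (Fin n → ℂ) := {z | Z.N z < 1}

/-- `‖Id : Z → ℓ^n_q‖ = sup_{z ∈ B_Z} ‖z‖_q`. -/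
def toLq (q : ℝ≥0∞) : ℝ := ⨆ z : Z.ball, lqNorm q z.1

/-- `‖Id : ℓ^n_q → Z‖ = sup_{‖z‖_q ≤ 1} ‖z‖_Z`. -/
def fromLq (q : ℝ≥0∞) : ℝ := ⨆ z : {w : Fin n → ℂ | lqNorm q w ≤ 1}, Z.N z.1

/-- `‖Id : Z → ℓ^n_1‖ = sup_{z ∈ B_Z} Σ_i |z_i|`. -/
def toL1 : ℝ := ⨆ z : Z.ball, ∑ i, ‖z.1 i‖

/-- `‖Id : ℓ^n_2 → Z‖`. -/
def fromL2 : ℝ := ⨆ z : {w : Fin n → ℂ | Real.sqrt (∑ i, ‖w i‖ ^ 2) ≤ 1}, Z.N z.1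

/-- `sup_{z ∈ B_Z} ‖z‖_p` for a real exponent `p`. -/
def supLp (p : ℝ) : ℝ := ⨆ z : Z.ball, lqNormR p z.1

end UncondNorm

section Pluriharmonic

variable {n : ℕ} {H : Type*} [NormedAddCommGroup H] [InnerProductSpace ℂ H] [CompleteSpace H]
variable {Y : Type*} [NormedAddCommGroup Y] [NormedSpace ℂ Y]

/-- `f : Ω → B(H)` is (representable as) a pluriharmonic function with coefficient
families `a`, `b`:  `f z = Σ_α a_α z^α + Σ_{|α| ≥ 1} b_α^* z̄^α` on `Ω`. -/
def Represents (Ω : Set (Fin n → ℂ)) (f : (Fin n → ℂ) → (H →L[ℂ] H))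
    (a b : (Fin n → ℕ) → (H →L[ℂ] H)) : Prop :=
  b 0 = 0 ∧ ∀ z ∈ Ω,
    Summable (fun α => mono z α • a α) ∧
    Summable (fun α => mono (star z) α • (ContinuousLinearMap.adjoint (b α))) ∧
    f z = (∑' α, mono z α • a α) +
      ∑' α, mono (star z) α • (ContinuousLinearMap.adjoint (b α))

/-- The class `PH(Ω, B(H))` of bounded pluriharmonic functions (with their coefficients). -/
def ClsPH (Ω : Set (Fin n → ℂ)) (f : (Fin n → ℂ) → (H →L[ℂ] H))
    (a b : (Fin n → ℕ) → (H →L[ℂ] H)) : Prop :=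
  Represents Ω f a b ∧ IsBoundedOn Ω f

/-- The class `PH(^mΩ, B(H))` of `m`-homogeneous pluriharmonic polynomials. -/
def ClsHomog (Ω : Set (Fin n → ℂ)) (m : ℕ) (f : (Fin n → ℂ) → (H →L[ℂ] H))
    (a b : (Fin n → ℕ) → (H →L[ℂ] H)) : Prop :=
  ClsPH Ω f a b ∧ ∀ α : Fin n → ℕ, (∑ i, α i) ≠ m → a α = 0 ∧ b α = 0

/-- The class `∪_{m ≥ 1} PH(^mΩ, B(H))`. -/
def ClsHomogUnion (Ω : Set (Fin n → ℂ)) (f : (Fin n → ℂ) → (H →L[ℂ] H))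
    (a b : (Fin n → ℕ) → (H →L[ℂ] H)) : Prop :=
  ∃ m : ℕ, 1 ≤ m ∧ ClsHomog Ω m f a b

/-- The class `PH*(Ω, B(H))` of bounded pluriharmonic `f` with `f(0) = μ I`,
`μ ∈ [0, ‖f‖_Ω]`. -/
def ClsPHStar (Ω : Set (Fin n → ℂ)) (f : (Fin n → ℂ) → (H →L[ℂ] H))
    (a b : (Fin n → ℕ) → (H →L[ℂ] H)) : Prop :=
  ClsPH Ω f a b ∧ ∃ μ : ℝ, 0 ≤ μ ∧ μ ≤ supNorm Ω f ∧ f 0 = (μ : ℂ) • (1 : H →L[ℂ] H)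

/-- The vector `r ∈ ℝ^n_{≥0}` witnesses the arithmetic Bohr inequality for the class `Cls`:
`Σ_α (‖U a_α‖^p + ‖U b_α‖^p) r^{pα} ≤ λ^p ‖f‖_Ω^p` for every `f` in the class. -/
def GoodVec (Ω : Set (Fin n → ℂ)) (p lam : ℝ) (U : (H →L[ℂ] H) →L[ℂ] Y)
    (Cls : ((Fin n → ℂ) → (H →L[ℂ] H)) → ((Fin n → ℕ) → (H →L[ℂ] H)) →
      ((Fin n → ℕ) → (H →L[ℂ] H)) → Prop) (r : Fin n → ℝ) : Prop :=
  ∀ f a b, Cls f a b → ∀ F : Finset (Fin n → ℕ),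
    ∑ α ∈ F, (‖U (a α)‖ ^ p + ‖U (b α)‖ ^ p) * monoR r α ^ p ≤ lam ^ p * supNorm Ω f ^ p

/-- The `λ_p`-arithmetic Bohr radius of `Ω` with respect to a class of pluriharmonic
functions. -/
def APgen (Ω : Set (Fin n → ℂ)) (p lam : ℝ) (U : (H →L[ℂ] H) →L[ℂ] Y)
    (Cls : ((Fin n → ℂ) → (H →L[ℂ] H)) → ((Fin n → ℕ) → (H →L[ℂ] H)) →
      ((Fin n → ℕ) → (H →L[ℂ] H)) → Prop) : ℝ :=
  sSup {t : ℝ | ∃ r : Fin n → ℝ, (∀ i, 0 ≤ r i) ∧ GoodVec Ω p lam U Cls r ∧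
    t = (∑ i, r i) / n}

/-- The `λ_p`-arithmetic Bohr radius `AP_λ(Ω, p, U)`. -/
def APradius (Ω : Set (Fin n → ℂ)) (p lam : ℝ) (U : (H →L[ℂ] H) →L[ℂ] Y) : ℝ :=
  APgen Ω p lam U (ClsPH Ω)

/-- The `λ`-powered Bohr radius `R_λ(Ω, p, U)`. -/
def BohrRadius (Ω : Set (Fin n → ℂ)) (p lam : ℝ) (U : (H →L[ℂ] H) →L[ℂ] Y) : ℝ :=
  sSup {r : ℝ | 0 ≤ r ∧ ∀ f a b, ClsPH Ω f a b → ∀ z ∈ Ω, ∀ F : Finset (Fin n → ℕ),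
    ∑ α ∈ F, (‖U (a α)‖ ^ p + ‖U (b α)‖ ^ p) * ‖mono (r • z) α‖ ^ p
      ≤ lam ^ p * supNorm Ω f ^ p}

/-- `sup_{|z| < 1} ‖f z‖`. -/
def supNormDisk {E : Type*} [Norm E] (f : ℂ → E) : ℝ := ⨆ z : {w : ℂ // ‖w‖ < 1}, ‖f z.1‖

/-- `f` is bounded on the unit disk. -/
def IsBoundedOnDisk {E : Type*} [Norm E] (f : ℂ → E) : Prop :=
  ∃ M : ℝ, ∀ z : ℂ, ‖z‖ < 1 → ‖f z‖ ≤ M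

/-- `f : 𝔻 → B(H)` is pluriharmonic with coefficients `a`, `b`:
`f z = Σ_m a_m z^m + Σ_{m ≥ 1} b_m^* z̄^m`. -/
def RepresentsDisk (f : ℂ → (H →L[ℂ] H)) (a b : ℕ → (H →L[ℂ] H)) : Prop :=
  b 0 = 0 ∧ ∀ z : ℂ, ‖z‖ < 1 →
    Summable (fun m => z ^ m • a m) ∧
    Summable (fun m => (starRingEnd ℂ z) ^ m • (ContinuousLinearMap.adjoint (b m))) ∧
    f z = (∑' m, z ^ m • a m) +
      ∑' m, (starRingEnd ℂ z) ^ m • (ContinuousLinearMap.adjoint (b m))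

/-- The one-dimensional `λ`-powered Bohr radius `R_λ(𝔻, p, U)`. -/
def BohrRadiusDisk (p lam : ℝ) (U : (H →L[ℂ] H) →L[ℂ] Y) : ℝ :=
  sSup {r : ℝ | 0 ≤ r ∧ ∀ f a b, RepresentsDisk f a b → IsBoundedOnDisk f →
    ∀ F : Finset ℕ, ∑ m ∈ F, (‖U (a m)‖ ^ p + ‖U (b m)‖ ^ p) * r ^ ((m : ℝ) * p)
      ≤ lam ^ p * supNormDisk f ^ p}

end Pluriharmonic

section Scalar

variable {n : ℕ}

/-- A complex-valued harmonic function on the unit disk, via its representation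
`f z = Σ_m a_m z^m + conj (Σ_{m ≥ 1} b_m z^m)`. -/
def RepresentsDiskC (f : ℂ → ℂ) (a b : ℕ → ℂ) : Prop :=
  b 0 = 0 ∧ ∀ z : ℂ, ‖z‖ < 1 →
    Summable (fun m => a m * z ^ m) ∧ Summable (fun m => b m * z ^ m) ∧
    f z = (∑' m, a m * z ^ m) + starRingEnd ℂ (∑' m, b m * z ^ m)

/-- The scalar one-dimensional Bohr radius `R_λ(𝔻, 1, ℂ)` for harmonic functions. -/
def BohrRadiusDiskC (lam : ℝ) : ℝ :=
  sSup {r : ℝ | 0 ≤ r ∧ ∀ f a b, RepresentsDiskC f a b → IsBoundedOnDisk f →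
    ∀ F : Finset ℕ, ∑ m ∈ F, (‖a m‖ + ‖b m‖) * r ^ m ≤ lam * supNormDisk f}

/-- A complex-valued pluriharmonic function on `Ω ⊆ ℂ^n`, via its representation
`f z = Σ_α a_α z^α + conj (Σ_{|α| ≥ 1} b_α z^α)`. -/
def RepresentsC (Ω : Set (Fin n → ℂ)) (f : (Fin n → ℂ) → ℂ) (a b : (Fin n → ℕ) → ℂ) :
    Prop :=
  b 0 = 0 ∧ ∀ z ∈ Ω,
    Summable (fun α => a α * mono z α) ∧ Summable (fun α => b α * mono z α) ∧
    f z = (∑' α, a α * mono z α) + starRingEnd ℂ (∑' α, b α * mono z α)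

/-- The scalar arithmetic Bohr radius `AP_λ(Ω, 1, ℂ)` for pluriharmonic functions. -/
def APradiusC (Ω : Set (Fin n → ℂ)) (lam : ℝ) : ℝ :=
  sSup {t : ℝ | ∃ r : Fin n → ℝ, (∀ i, 0 ≤ r i) ∧
    (∀ f a b, RepresentsC Ω f a b → IsBoundedOn Ω f →
      ∀ F : Finset (Fin n → ℕ), ∑ α ∈ F, (‖a α‖ + ‖b α‖) * monoR r α ≤ lam * supNorm Ω f) ∧
    t = (∑ i, r i) / n}

end Scalar

section Holomorphic

variable {n : ℕ} {X : Type*} [NormedAddCommGroup X] [NormedSpace ℂ X]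
variable {Y : Type*} [NormedAddCommGroup Y] [NormedSpace ℂ Y]

/-- `f : Ω → X` has the monomial expansion `f z = Σ_α a_α z^α` on `Ω`. -/
def RepresentsHol (Ω : Set (Fin n → ℂ)) (f : (Fin n → ℂ) → X)
    (a : (Fin n → ℕ) → X) : Prop :=
  ∀ z ∈ Ω, HasSum (fun α => mono z α • a α) (f z)

/-- The `λ`-powered Bohr radius `K_λ(Ω, p, U)` for holomorphic functions. -/
def Kradius (Ω : Set (Fin n → ℂ)) (p lam : ℝ) (U : X →L[ℂ] Y) : ℝ :=
  sSup {r : ℝ | 0 ≤ r ∧ ∀ f a, RepresentsHol Ω f a → IsBoundedOn Ω f →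
    ∀ z ∈ Ω, ∀ F : Finset (Fin n → ℕ),
      ∑ α ∈ F, ‖mono (r • z) α • U (a α)‖ ^ p ≤ lam ^ p * supNorm Ω f ^ p}

/-- The `λ_p`-arithmetic Bohr radius `A_λ(Ω, p, U)` for holomorphic functions. -/
def Aradius (Ω : Set (Fin n → ℂ)) (p lam : ℝ) (U : X →L[ℂ] Y) : ℝ :=
  sSup {t : ℝ | ∃ r : Fin n → ℝ, (∀ i, 0 ≤ r i) ∧
    (∀ f a, RepresentsHol Ω f a → IsBoundedOn Ω f →
      ∀ F : Finset (Fin n → ℕ),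
        ∑ α ∈ F, ‖U (a α)‖ ^ p * monoR r α ^ p ≤ lam ^ p * supNorm Ω f ^ p) ∧
    t = (∑ i, r i) / n}

/-- `f : 𝔻 → X` has the power-series expansion `f z = Σ_m a_m z^m`. -/
def RepresentsHolDisk (f : ℂ → X) (a : ℕ → X) : Prop :=
  ∀ z : ℂ, ‖z‖ < 1 → HasSum (fun m => z ^ m • a m) (f z)

/-- The one-dimensional `λ`-powered Bohr radius `K_λ(𝔻, p, U)`. -/
def KradiusDisk (p lam : ℝ) (U : X →L[ℂ] Y) : ℝ :=
  sSup {r : ℝ | 0 ≤ r ∧ ∀ f a, RepresentsHolDisk f a → IsBoundedOnDisk f →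
    ∀ F : Finset ℕ, ∑ m ∈ F, ‖U (a m)‖ ^ p * r ^ ((m : ℝ) * p) ≤ lam ^ p * supNormDisk f ^ p}

end Holomorphic

/-- `X` has cotype `t ∈ [2, ∞)`. -/
def HasCotype (X : Type*) [NormedAddCommGroup X] (t : ℝ) : Prop :=
  ∃ C : ℝ, 0 < C ∧ ∀ (m : ℕ) (x : Fin m → X),
    (∑ k, ‖x k‖ ^ t) ^ (1 / t) ≤
      C * Real.sqrt ((2 ^ m : ℝ)⁻¹ * ∑ ε : Fin m → Bool, ‖∑ k, (if ε k then x k else -x k)‖ ^ 2)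

/-- `Cot(X) = inf {t ∈ [2, ∞] : X has cotype t}` (every space has cotype `∞`). -/
def cotype (X : Type*) [NormedAddCommGroup X] : ℝ≥0∞ :=
  sInf {t : ℝ≥0∞ | 2 ≤ t ∧ (t ≠ ∞ → HasCotype X t.toReal)}

/-- `X` has cotype `t ∈ [2, ∞]` (extended-real exponent; cotype `∞` always holds). -/
def HasCotypeE (X : Type*) [NormedAddCommGroup X] (t : ℝ≥0∞) : Prop :=
  t = ∞ ∨ HasCotype X t.toReal

/-- The constant `D` of Theorem 1.1 / Theorem `thm-1.8-atm`. -/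
def Dconst (p lam u : ℝ) : ℝ :=
  if (4 * lam * (2 : ℝ) ^ (1 / p))⁻¹ ≤ u then
    max ((4 * lam * (2 : ℝ) ^ (1 / p))⁻¹ * ((lam ^ p - u ^ p) / (2 * lam ^ p - u ^ p)) ^ (1 / p))
      ((4 * lam * (2 : ℝ) ^ (1 / p))⁻¹ *
        ((lam ^ p - u ^ p) / (lam ^ p - u ^ p + 1)) ^ (1 / p) * u⁻¹)
  else
    max ((4 * lam * (2 : ℝ) ^ (1 / p))⁻¹ * ((lam ^ p - u ^ p) / (2 * lam ^ p - u ^ p)) ^ (1 / p))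
      ((4 * lam * (2 : ℝ) ^ (1 / p))⁻¹ * ((lam ^ p - u ^ p) / (lam ^ p - u ^ p + 1)) ^ (1 / p))

end ArithBohr

namespace ArithBohr

/-- Existence of good signs, by successive averaging. -/
lemma exists_signs_aux {ι κ : Type*} [DecidableEq ι] (A : Finset ι) (J : Finset κ)
    (x : κ → ι → ℝ) : ∀ w : κ → ℝ, (∀ j, 0 ≤ w j) →
    ∃ ε : ι → ℝ, (∀ i, ε i = 1 ∨ ε i = -1) ∧
      ∑ j ∈ J, w j * Real.exp (∑ i ∈ A, ε i * x j i) ≤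
        ∑ j ∈ J, w j * Real.exp (∑ i ∈ A, x j i ^ 2 / 2) := by
  induction A using Finset.induction_on with
  | empty =>
    intro w _
    exact ⟨fun _ => 1, fun _ => Or.inl rfl, by simp⟩
  | insert a A ha ih =>
    intro w hw
    obtain ⟨ε, hε, h⟩ := ih (fun j => w j * Real.cosh (x j a))
      (fun j => mul_nonneg (hw j) (Real.cosh_pos _).le)
    have key : ∀ s : ℝ, ∑ j ∈ J, w j * Real.exp (∑ i ∈ insert a A, (Function.update ε a s) i * x j i)
        = ∑ j ∈ J, w j * (Real.exp (s * x j a) * Real.exp (∑ i ∈ A, ε i * x j i)) := by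
      intro s
      refine Finset.sum_congr rfl fun j _ => ?_
      rw [Finset.sum_insert ha, Real.exp_add, Function.update_self]
      congr 3
      refine Finset.sum_congr rfl fun i hi => ?_
      rw [Function.update_of_ne]
      rintro rfl; exact ha hi
    have hb : ∑ j ∈ J, w j * Real.cosh (x j a) * Real.exp (∑ i ∈ A, x j i ^ 2 / 2) ≤
        ∑ j ∈ J, w j * Real.exp (∑ i ∈ insert a A, x j i ^ 2 / 2) := by
      refine Finset.sum_le_sum fun j _ => ?_
      rw [Finset.sum_insert ha, Real.exp_add, mul_assoc]
      exact mul_le_mul_of_nonneg_left (mul_le_mul_of_nonneg_right (Real.cosh_le_exp_half_sq _)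
        (Real.exp_pos _).le) (hw j)
    have havg : (∑ j ∈ J, w j * (Real.exp (1 * x j a) * Real.exp (∑ i ∈ A, ε i * x j i))) +
        (∑ j ∈ J, w j * (Real.exp (-1 * x j a) * Real.exp (∑ i ∈ A, ε i * x j i))) =
        2 * ∑ j ∈ J, w j * Real.cosh (x j a) * Real.exp (∑ i ∈ A, ε i * x j i) := by
      rw [← Finset.sum_add_distrib, Finset.mul_sum]
      refine Finset.sum_congr rfl fun j _ => ?_
      rw [Real.cosh_eq, one_mul, neg_one_mul]
      ring
    have hsgn : ∀ s : ℝ, (s = 1 ∨ s = -1) → ∀ i, Function.update ε a s i = 1 ∨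
        Function.update ε a s i = -1 := by
      intro s hs i
      by_cases hi : i = a
      · subst hi; simpa using hs
      · simpa [Function.update_of_ne hi] using hε i
    by_cases hc : ∑ j ∈ J, w j * (Real.exp (1 * x j a) * Real.exp (∑ i ∈ A, ε i * x j i)) ≤
        ∑ j ∈ J, w j * Real.cosh (x j a) * Real.exp (∑ i ∈ A, ε i * x j i)
    · refine ⟨Function.update ε a 1, hsgn 1 (Or.inl rfl), ?_⟩
      rw [key]; linarith
    · refine ⟨Function.update ε a (-1), hsgn (-1) (Or.inr rfl), ?_⟩
      rw [key]; linarith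

lemma exists_signs {ι κ : Type*} [DecidableEq ι] (A : Finset ι) (J : Finset κ)
    (x : κ → ι → ℝ) (σ : ℝ) (hσ : 0 < σ) (hx : ∀ j ∈ J, ∑ i ∈ A, x j i ^ 2 ≤ σ ^ 2) :
    ∃ ε : ι → ℝ, (∀ i, ε i = 1 ∨ ε i = -1) ∧
      ∀ j ∈ J, ∑ i ∈ A, ε i * x j i ≤ σ * (Real.log (J.card : ℝ) + 1 / 2) := by
  obtain ⟨ε, hε, h⟩ := exists_signs_aux A J (fun j i => x j i / σ) (fun _ => 1) (fun _ => zero_le_one)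
  refine ⟨ε, hε, fun j hj => ?_⟩
  have h1 : ∑ j ∈ J, 1 * Real.exp (∑ i ∈ A, (x j i / σ) ^ 2 / 2) ≤ J.card * Real.exp (1 / 2) := by
    rw [← nsmul_eq_mul]
    refine Finset.sum_le_card_nsmul _ _ _ fun j hj => ?_
    rw [one_mul]
    apply Real.exp_le_exp.2
    rw [← Finset.sum_div]
    have : ∑ i ∈ A, (x j i / σ) ^ 2 = (∑ i ∈ A, x j i ^ 2) / σ ^ 2 := by
      rw [Finset.sum_div]; simp_rw [div_pow]
    rw [this]
    have : (∑ i ∈ A, x j i ^ 2) / σ ^ 2 ≤ 1 := by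
      rw [div_le_one (by positivity)]; exact hx j hj
    linarith
  have h2 : Real.exp (∑ i ∈ A, ε i * (x j i / σ)) ≤
      ∑ j ∈ J, 1 * Real.exp (∑ i ∈ A, ε i * (x j i / σ)) := by
    simp_rw [one_mul]
    exact Finset.single_le_sum (f := fun j => Real.exp (∑ i ∈ A, ε i * (x j i / σ)))
      (fun _ _ => (Real.exp_pos _).le) hj
  have hJ : (0 : ℝ) < J.card := by exact_mod_cast Finset.card_pos.2 ⟨j, hj⟩
  have h3 : Real.exp (∑ i ∈ A, ε i * (x j i / σ)) ≤ Real.exp (Real.log J.card + 1 / 2) := by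
    rw [Real.exp_add, Real.exp_log hJ]; exact h2.trans (h.trans h1)
  have h4 := Real.exp_le_exp.1 h3
  have h5 : ∑ i ∈ A, ε i * (x j i / σ) = (∑ i ∈ A, ε i * x j i) / σ := by
    rw [Finset.sum_div]; exact Finset.sum_congr rfl fun i _ => by ring
  rw [h5, div_le_iff₀ hσ] at h4
  linarith

/-- telescoping estimate for products -/
lemma norm_prod_sub_le {ι : Type*} [DecidableEq ι] (s : Finset ι) (f g : ι → ℂ) (δ : ι → ℝ)
    (hf : ∀ i, ‖f i‖ ≤ 1) (hg : ∀ i, ‖g i‖ ≤ 1) (h : ∀ i, ‖f i - g i‖ ≤ δ i) :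
    ‖∏ i ∈ s, f i - ∏ i ∈ s, g i‖ ≤ ∑ i ∈ s, δ i := by
  induction s using Finset.induction_on with
  | empty => simp
  | insert a s ha ih =>
    rw [Finset.prod_insert ha, Finset.prod_insert ha, Finset.sum_insert ha]
    have e : f a * ∏ i ∈ s, f i - g a * ∏ i ∈ s, g i =
      (f a - g a) * ∏ i ∈ s, f i + g a * (∏ i ∈ s, f i - ∏ i ∈ s, g i) := by ring
    rw [e]
    have hp : ‖∏ i ∈ s, f i‖ ≤ 1 := by
      rw [norm_prod]; exact Finset.prod_le_one (fun _ _ => norm_nonneg _) fun i _ => hf i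
    refine (norm_add_le _ _).trans (add_le_add ?_ ?_)
    · rw [norm_mul]
      calc _ ≤ ‖f a - g a‖ * 1 := by gcongr
        _ ≤ _ := by simpa using h a
    · rw [norm_mul]
      calc _ ≤ 1 * ‖∏ i ∈ s, f i - ∏ i ∈ s, g i‖ := by gcongr; exact hg a
        _ ≤ _ := by simpa using ih

lemma norm_mono_sub_le {n : ℕ} (z w : Fin n → ℂ) (δ : ℝ) (hz : ∀ i, ‖z i‖ ≤ 1)
    (hw : ∀ i, ‖w i‖ ≤ 1) (h : ∀ i, ‖z i - w i‖ ≤ δ) (α : Fin n → ℕ) :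
    ‖mono z α - mono w α‖ ≤ (∑ i, α i : ℕ) * δ := by
  have := norm_prod_sub_le Finset.univ (fun i => z i ^ α i) (fun i => w i ^ α i)
    (fun i => α i * δ) (fun i => by rw [norm_pow]; exact pow_le_one₀ (norm_nonneg _) (hz i))
    (fun i => by rw [norm_pow]; exact pow_le_one₀ (norm_nonneg _) (hw i)) (fun i => by
      have := norm_prod_sub_le (Finset.range (α i)) (fun _ => z i) (fun _ => w i) (fun _ => δ)
        (fun _ => hz i) (fun _ => hw i) (fun _ => h i)
      simpa using this)
  push_cast
  rw [Finset.sum_mul]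
  exact this

lemma norm_mono {n : ℕ} (z : Fin n → ℂ) (α : Fin n → ℕ) :
    ‖mono z α‖ = ∏ i, ‖z i‖ ^ α i := by
  simp [mono, norm_prod]

/-- multi-indices of order `m` -/
def idx (n m : ℕ) : Finset (Fin n → ℕ) := Finset.piAntidiag Finset.univ m

/-- multinomial coefficient -/
def cf {n : ℕ} (α : Fin n → ℕ) : ℝ := (Nat.multinomial Finset.univ α : ℝ)

lemma mem_idx {n m : ℕ} {α : Fin n → ℕ} : α ∈ idx n m ↔ ∑ i, α i = m := by
  simp [idx]

lemma one_le_cf {n : ℕ} (α : Fin n → ℕ) : 1 ≤ cf α := by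
  unfold cf; exact_mod_cast Nat.multinomial_pos _ _

lemma cf_le {n m : ℕ} {α : Fin n → ℕ} (h : α ∈ idx n m) : cf α ≤ (m.factorial : ℝ) := by
  unfold cf
  rw [mem_idx] at h
  have := Nat.multinomial_spec Finset.univ α
  rw [h] at this
  rw [← this]
  exact_mod_cast Nat.le_mul_of_pos_left _ (Nat.prod_factorial_pos _ _)

lemma sum_cf {n m : ℕ} (x : Fin n → ℝ) :
    ∑ α ∈ idx n m, cf α * ∏ i, x i ^ α i = (∑ i, x i) ^ m := by
  rw [Finset.sum_pow_eq_sum_piAntidiag]; rfl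

lemma sum_cf_one (n m : ℕ) : ∑ α ∈ idx n m, cf α = (n : ℝ) ^ m := by
  have := sum_cf (m := m) (fun _ : Fin n => (1 : ℝ))
  simpa using this

lemma card_idx (n m : ℕ) : ((idx n m).card : ℝ) ≤ (n : ℝ) ^ m := by
  rw [← sum_cf_one]
  have := Finset.card_nsmul_le_sum (idx n m) cf 1 (fun α _ => one_le_cf α)
  simpa using this

/-- Variance bound. -/
lemma var_bound {n m : ℕ} {s : ℝ} (hs1 : 1 ≤ s) (hs2 : s ≤ 2) (w : Fin n → ℂ)
    (hw : ∑ i, ‖w i‖ ^ s ≤ 1) :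
    ∑ α ∈ idx n m, (cf α * ‖mono w α‖) ^ 2 ≤ (((m.factorial : ℝ)) ^ (1 - 1 / s)) ^ 2 := by
  set σ : ℝ := (m.factorial : ℝ) ^ (1 - 1 / s) with hσ
  have hm : (1 : ℝ) ≤ m.factorial := by exact_mod_cast Nat.factorial_pos m
  have hσ0 : 0 < σ := by positivity
  have hs0 : 0 < s := by linarith
  have hσs : σ ^ s = (m.factorial : ℝ) ^ (s - 1) := by
    rw [hσ, ← Real.rpow_mul (by positivity)]; congr 1; field_simp
  have hy0 : ∀ α : Fin n → ℕ, 0 ≤ cf α * ‖mono w α‖ := fun α =>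
    mul_nonneg (zero_le_one.trans (one_le_cf α)) (norm_nonneg _)
  have hys : ∀ α ∈ idx n m, (cf α * ‖mono w α‖) ^ s ≤
      (m.factorial : ℝ) ^ (s - 1) * (cf α * ∏ i, (‖w i‖ ^ s) ^ α i) := by
    intro α hα
    have hc := one_le_cf α
    rw [Real.mul_rpow (by linarith) (norm_nonneg _)]
    have e1 : ‖mono w α‖ ^ s = ∏ i, (‖w i‖ ^ s) ^ α i := by
      rw [norm_mono, ← Real.finsetProd_rpow _ _ (fun i _ => by positivity)]
      refine Finset.prod_congr rfl fun i _ => ?_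
      rw [← Real.rpow_natCast, ← Real.rpow_natCast, ← Real.rpow_mul (norm_nonneg _),
        ← Real.rpow_mul (norm_nonneg _), mul_comm]
    rw [e1, ← mul_assoc]
    refine mul_le_mul_of_nonneg_right ?_ (Finset.prod_nonneg fun i _ => by positivity)
    calc cf α ^ s = cf α ^ (s - 1) * cf α := by
          rw [← Real.rpow_add_one (by linarith)]; congr 1; ring
      _ ≤ _ := by
          gcongr
          exact cf_le hα
  have hsum : ∑ α ∈ idx n m, (cf α * ‖mono w α‖) ^ s ≤ σ ^ s := by
    refine (Finset.sum_le_sum hys).trans ?_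
    rw [← Finset.mul_sum, sum_cf, hσs]
    have : (∑ i, ‖w i‖ ^ s) ^ m ≤ 1 :=
      pow_le_one₀ (Finset.sum_nonneg fun i _ => by positivity) hw
    exact mul_le_of_le_one_right (by positivity) this
  have hle : ∀ α ∈ idx n m, cf α * ‖mono w α‖ ≤ σ := by
    intro α hα
    rw [← Real.rpow_le_rpow_iff (hy0 α) hσ0.le hs0]
    refine le_trans ?_ hsum
    exact Finset.single_le_sum (f := fun α => (cf α * ‖mono w α‖) ^ s)
      (fun α _ => Real.rpow_nonneg (hy0 α) _) hα
  calc ∑ α ∈ idx n m, (cf α * ‖mono w α‖) ^ 2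
      ≤ ∑ α ∈ idx n m, (cf α * ‖mono w α‖) ^ s * σ ^ (2 - s) := by
        refine Finset.sum_le_sum fun α hα => ?_
        have : (cf α * ‖mono w α‖) ^ 2 = (cf α * ‖mono w α‖) ^ s * (cf α * ‖mono w α‖) ^ (2 - s) := by
          rw [← Real.rpow_add_of_nonneg (hy0 α) hs0.le (by linarith)]
          rw [← Real.rpow_natCast]; congr 1; push_cast; ring
        rw [this]
        refine mul_le_mul_of_nonneg_left ?_ (Real.rpow_nonneg (hy0 α) _)
        exact Real.rpow_le_rpow (hy0 α) (hle α hα) (by linarith)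
    _ ≤ σ ^ s * σ ^ (2 - s) := by
        rw [← Finset.sum_mul]; gcongr
    _ = σ ^ 2 := by
        rw [← Real.rpow_add hσ0, ← Real.rpow_natCast]; congr 1; push_cast; ring

end ArithBohr
namespace ArithBohr

lemma round_real (N : ℕ) (hN : 0 < N) (t : ℝ) (ht : |t| ≤ 1) :
    ∃ k : ℤ, k ∈ Finset.Icc (-(N : ℤ)) N ∧ |(k : ℝ) / N| ≤ |t| ∧ |t - (k : ℝ) / N| ≤ 1 / N := by
  have hN' : (0 : ℝ) < N := by exact_mod_cast hN
  have main : ∀ u : ℝ, 0 ≤ u → u ≤ 1 → ∃ k : ℤ, 0 ≤ k ∧ k ≤ N ∧ (k : ℝ) / N ≤ u ∧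
      u - (k : ℝ) / N ≤ 1 / N := by
    intro u h0 h1
    have f1 := Int.floor_le (u * N)
    have f2 := Int.lt_floor_add_one (u * N)
    refine ⟨⌊u * N⌋, Int.floor_nonneg.2 (by positivity), ?_, ?_, ?_⟩
    · have : ((⌊u * N⌋ : ℤ) : ℝ) ≤ ((N : ℤ) : ℝ) := by push_cast; nlinarith
      exact_mod_cast this
    · rw [div_le_iff₀ hN']; exact f1
    · rw [sub_le_iff_le_add, ← add_div, le_div_iff₀ hN']; linarith
  rcases le_total 0 t with h | h
  · rw [abs_of_nonneg h] at ht
    obtain ⟨k, k0, kN, h1, h2⟩ := main t h ht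
    have k0' : (0 : ℝ) ≤ (k : ℝ) / N := div_nonneg (by exact_mod_cast k0) hN'.le
    refine ⟨k, by rw [Finset.mem_Icc]; omega, ?_, ?_⟩
    · rw [abs_of_nonneg k0', abs_of_nonneg h]; exact h1
    · rw [abs_of_nonneg (by linarith)]; exact h2
  · rw [abs_of_nonpos h] at ht
    obtain ⟨k, k0, kN, h1, h2⟩ := main (-t) (by linarith) ht
    have k0' : (0 : ℝ) ≤ (k : ℝ) / N := div_nonneg (by exact_mod_cast k0) hN'.le
    refine ⟨-k, by rw [Finset.mem_Icc]; omega, ?_, ?_⟩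
    · push_cast; rw [neg_div, abs_neg, abs_of_nonneg k0', abs_of_nonpos h]; exact h1
    · push_cast; rw [neg_div, abs_of_nonpos (by linarith)]; linarith

/-- grid in the complex plane -/
def grid (N : ℕ) : Finset ℂ :=
  ((Finset.Icc (-(N : ℤ)) N) ×ˢ (Finset.Icc (-(N : ℤ)) N)).image
    (fun k => (⟨(k.1 : ℝ) / N, (k.2 : ℝ) / N⟩ : ℂ))

lemma card_grid (N : ℕ) : (grid N).card ≤ (2 * N + 1) ^ 2 := by
  refine Finset.card_image_le.trans ?_
  rw [Finset.card_product, Int.card_Icc, sq]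
  have : ((N : ℤ) + 1 - -(N : ℤ)).toNat = 2 * N + 1 := by omega
  rw [this]

lemma round_complex (N : ℕ) (hN : 0 < N) (z : ℂ) (hz : ‖z‖ ≤ 1) :
    ∃ w ∈ grid N, ‖w‖ ≤ ‖z‖ ∧ ‖z - w‖ ≤ 2 / N := by
  obtain ⟨k, hk, k1, k2⟩ := round_real N hN z.re ((Complex.abs_re_le_norm z).trans hz)
  obtain ⟨l, hl, l1, l2⟩ := round_real N hN z.im ((Complex.abs_im_le_norm z).trans hz)
  refine ⟨⟨(k : ℝ) / N, (l : ℝ) / N⟩, ?_, ?_, ?_⟩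
  · exact Finset.mem_image.2 ⟨(k, l), Finset.mem_product.2 ⟨hk, hl⟩, rfl⟩
  · rw [← abs_of_nonneg (norm_nonneg z), ← abs_of_nonneg (norm_nonneg (Complex.mk _ _)),
      ← sq_le_sq, Complex.sq_norm, Complex.sq_norm, Complex.normSq_apply, Complex.normSq_apply]
    have := sq_le_sq.2 k1
    have := sq_le_sq.2 l1
    simp only
    nlinarith
  · refine (Complex.norm_le_abs_re_add_abs_im _).trans ?_
    simp only [Complex.sub_re, Complex.sub_im]
    have : (2 : ℝ) / N = 1 / N + 1 / N := by ring
    linarith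

/-- The random polynomial. -/
lemma exists_poly {n m : ℕ} (hn : 1 ≤ n) (hm : 1 ≤ m) {s : ℝ} (hs1 : 1 ≤ s) (hs2 : s ≤ 2) :
    ∃ ε : (Fin n → ℕ) → ℝ, (∀ α, ε α = 1 ∨ ε α = -1) ∧
      ∀ z : Fin n → ℂ, ∑ i, ‖z i‖ ^ s ≤ 1 →
        ‖∑ α ∈ idx n m, mono z α * ((ε α * cf α : ℝ) : ℂ)‖ ≤
          (m.factorial : ℝ) ^ (1 - 1 / s) *
            (2 + 2 * Real.log (4 * (2 * (2 * m * n ^ m : ℕ) + 1) ^ (2 * n))) := by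
  classical
  set N : ℕ := 2 * m * n ^ m with hN
  have hN0 : 0 < N := by positivity
  set σ : ℝ := (m.factorial : ℝ) ^ (1 - 1 / s) with hσ
  have hs0 : 0 < s := by linarith
  have hσ1 : 1 ≤ σ := Real.one_le_rpow (by exact_mod_cast Nat.factorial_pos m)
    (by rw [sub_nonneg, div_le_one hs0]; exact hs1)
  have hσ0 : 0 < σ := by linarith
  set G : Finset (Fin n → ℂ) := (Fintype.piFinset (fun _ => grid N)).filter
    (fun w => ∑ i, ‖w i‖ ^ s ≤ 1) with hG
  set D : Finset ℂ := {1, -1, Complex.I, -Complex.I} with hD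
  have hDn : ∀ u ∈ D, ‖u‖ = 1 := by
    intro u hu
    simp only [hD, Finset.mem_insert, Finset.mem_singleton] at hu
    rcases hu with rfl | rfl | rfl | rfl <;> simp
  obtain ⟨ε, hε, h⟩ := exists_signs (idx n m) (G ×ˢ D)
    (fun j α => (j.2 * (mono j.1 α * (cf α : ℂ))).re) σ hσ0 (by
      rintro ⟨w, u⟩ hj
      rw [Finset.mem_product] at hj
      have hw := (Finset.mem_filter.1 hj.1).2
      refine le_trans (Finset.sum_le_sum fun α _ => ?_) (var_bound (m := m) hs1 hs2 w hw)
      apply sq_le_sq.2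
      refine (Complex.abs_re_le_norm _).trans ?_
      rw [norm_mul, hDn _ hj.2, one_mul, norm_mul, Complex.norm_real, Real.norm_eq_abs,
        abs_of_nonneg (zero_le_one.trans (one_le_cf α)), mul_comm]
      exact le_abs_self _)
  refine ⟨ε, hε, fun z hz => ?_⟩
  have hz1 : ∀ i, ‖z i‖ ≤ 1 := by
    intro i
    have : ‖z i‖ ^ s ≤ 1 := (Finset.single_le_sum (f := fun i => ‖z i‖ ^ s)
      (fun i _ => by positivity) (Finset.mem_univ i)).trans hz
    rw [← Real.rpow_le_rpow_iff (norm_nonneg _) zero_le_one hs0, Real.one_rpow]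
    exact this
  choose w hw1 hw2 hw3 using fun i => round_complex N hN0 (z i) (hz1 i)
  have hwG : w ∈ G := by
    rw [hG, Finset.mem_filter]
    refine ⟨Fintype.mem_piFinset.2 hw1, le_trans (Finset.sum_le_sum fun i _ => ?_) hz⟩
    exact Real.rpow_le_rpow (norm_nonneg _) (hw2 i) hs0.le
  have hcard : ((G ×ˢ D).card : ℝ) ≤ 4 * (2 * (N : ℝ) + 1) ^ (2 * n) := by
    have h1 : G.card ≤ ((2 * N + 1) ^ 2) ^ n := by
      refine (Finset.card_filter_le _ _).trans ?_
      rw [Fintype.card_piFinset]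
      simp only [Finset.prod_const, Finset.card_univ, Fintype.card_fin]
      exact Nat.pow_le_pow_left (card_grid N) n
    have h2 : D.card ≤ 4 := Finset.card_le_four
    rw [Finset.card_product]
    have h3 : G.card * D.card ≤ 4 * (2 * N + 1) ^ (2 * n) := by
      rw [pow_mul, mul_comm]; exact Nat.mul_le_mul h2 h1
    exact_mod_cast h3
  set P : (Fin n → ℂ) → ℂ := fun z => ∑ α ∈ idx n m, mono z α * ((ε α * cf α : ℝ) : ℂ) with hP
  have hcardpos : (0 : ℝ) < ((G ×ˢ D).card : ℝ) := by
    have h1D : (1 : ℂ) ∈ D := by simp [hD]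
    have hp : 0 < (G ×ˢ D).card := Finset.card_pos.2 ⟨(w, 1), Finset.mem_product.2 ⟨hwG, h1D⟩⟩
    exact_mod_cast hp
  set B : ℝ := Real.log (4 * (2 * (N : ℝ) + 1) ^ (2 * n)) with hB
  have hdir : ∀ u ∈ D, (u * P w).re ≤ σ * (B + 1 / 2) := by
    intro u hu
    have := h (w, u) (Finset.mem_product.2 ⟨hwG, hu⟩)
    have e : (u * P w).re = ∑ α ∈ idx n m, ε α * (u * (mono w α * (cf α : ℂ))).re := by
      rw [hP, Finset.mul_sum, Complex.re_sum]
      refine Finset.sum_congr rfl fun α _ => ?_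
      rw [← Complex.re_ofReal_mul]; congr 1; push_cast; ring
    rw [e]
    refine this.trans ?_
    have : Real.log ((G ×ˢ D).card : ℝ) ≤ B := Real.log_le_log hcardpos hcard
    gcongr
  have hPw : ‖P w‖ ≤ 2 * (σ * (B + 1 / 2)) := by
    have d1 := hdir 1 (by simp [hD])
    have d2 := hdir (-1) (by simp [hD])
    have d3 := hdir Complex.I (by simp [hD])
    have d4 := hdir (-Complex.I) (by simp [hD])
    simp at d1 d2 d3 d4
    refine (Complex.norm_le_abs_re_add_abs_im _).trans ?_
    have a1 : |(P w).re| ≤ σ * (B + 1 / 2) := abs_le.2 ⟨by norm_num; linarith, by norm_num; linarith⟩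
    have a2 : |(P w).im| ≤ σ * (B + 1 / 2) := abs_le.2 ⟨by norm_num; linarith, by norm_num; linarith⟩
    linarith
  have hdiff : ‖P z - P w‖ ≤ 1 := by
    have e : P z - P w = ∑ α ∈ idx n m, (mono z α - mono w α) * ((ε α * cf α : ℝ) : ℂ) := by
      rw [hP, ← Finset.sum_sub_distrib]
      exact Finset.sum_congr rfl fun α _ => by ring
    rw [e]
    have hN' : (0 : ℝ) < N := by exact_mod_cast hN0
    calc _ ≤ ∑ α ∈ idx n m, (m * (2 / N : ℝ)) * cf α := by
          refine norm_sum_le_of_le _ fun α hα => ?_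
          have h1 := norm_mono_sub_le z w (2 / N) hz1 (fun i => (hw2 i).trans (hz1 i)) hw3 α
          rw [mem_idx.1 hα] at h1
          rw [norm_mul, Complex.norm_real, Real.norm_eq_abs, abs_mul,
            abs_of_nonneg (zero_le_one.trans (one_le_cf α))]
          have : |ε α| = 1 := by rcases hε α with h | h <;> simp [h]
          rw [this, one_mul]
          exact mul_le_mul_of_nonneg_right h1 (zero_le_one.trans (one_le_cf α))
      _ = 1 := by
          rw [← Finset.mul_sum, sum_cf_one]
          have hnn : (N : ℝ) = 2 * m * n ^ m := by rw [hN]; push_cast; ring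
          rw [← mul_div_assoc, div_mul_eq_mul_div, div_eq_one_iff_eq hN'.ne', hnn]; ring
  have : ‖P z‖ ≤ ‖P z - P w‖ + ‖P w‖ := by simpa using norm_add_le (P z - P w) (P w)
  change ‖P z‖ ≤ σ * (2 + 2 * B)
  nlinarith

end ArithBohr
namespace ArithBohr

lemma norm_le_lqNormR {n : ℕ} {s : ℝ} (hs : 0 < s) (z : Fin n → ℂ) (i : Fin n) :
    ‖z i‖ ≤ lqNormR s z := by
  unfold lqNormR
  have : ‖z i‖ ^ s ≤ ∑ i, ‖z i‖ ^ s := Finset.single_le_sum (f := fun i => ‖z i‖ ^ s)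
      (fun i _ => by positivity) (Finset.mem_univ i)
  calc ‖z i‖ = (‖z i‖ ^ s) ^ (1 / s) := by
        rw [← Real.rpow_mul (norm_nonneg _), mul_one_div_cancel hs.ne', Real.rpow_one]
    _ ≤ _ := Real.rpow_le_rpow (by positivity) this (by positivity)

lemma lqNorm_nonneg {n : ℕ} (q : ℝ≥0∞) (z : Fin n → ℂ) : 0 ≤ lqNorm q z := by
  unfold lqNorm
  split_ifs
  · exact Real.iSup_nonneg fun _ => norm_nonneg _
  · exact Real.rpow_nonneg (Finset.sum_nonneg fun i _ => by positivity) _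

lemma toLq_nonneg {n : ℕ} (Z : UncondNorm n) (q : ℝ≥0∞) : 0 ≤ Z.toLq q :=
  Real.iSup_nonneg fun _ => lqNorm_nonneg _ _

lemma lqNorm_le_of_coord {n : ℕ} {q : ℝ≥0∞} (z : Fin n → ℂ) (R : Fin n → ℝ)
    (h : ∀ i, ‖z i‖ ≤ R i) : lqNorm q z ≤ ∑ i, R i + (∑ i, R i ^ q.toReal) ^ (1 / q.toReal) := by
  have hR : ∀ i, 0 ≤ R i := fun i => (norm_nonneg _).trans (h i)
  have h1 : 0 ≤ ∑ i, R i := Finset.sum_nonneg fun i _ => hR i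
  have h2 : 0 ≤ (∑ i, R i ^ q.toReal) ^ (1 / q.toReal) :=
    Real.rpow_nonneg (Finset.sum_nonneg fun i _ => Real.rpow_nonneg (hR i) _) _
  unfold lqNorm
  split_ifs with hi
  · have : ⨆ i, ‖z i‖ ≤ ∑ i, R i := Real.iSup_le (fun i => (h i).trans
      (Finset.single_le_sum (f := R) (fun i _ => hR i) (Finset.mem_univ i))) h1
    linarith
  · have : (∑ i, ‖z i‖ ^ q.toReal) ^ (1 / q.toReal) ≤ (∑ i, R i ^ q.toReal) ^ (1 / q.toReal) := by
      refine Real.rpow_le_rpow (Finset.sum_nonneg fun i _ => by positivity) ?_ (by positivity)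
      exact Finset.sum_le_sum fun i _ => Real.rpow_le_rpow (norm_nonneg _) (h i) (by positivity)
    linarith

lemma coord_le {n : ℕ} (Z : UncondNorm n) (z : Fin n → ℂ) (hz : z ∈ Z.ball) (i : Fin n) :
    ‖z i‖ ≤ (Z.N (Pi.single i 1))⁻¹ := by
  have hz' : Z.N z < 1 := hz
  have hnn : ∀ w, 0 ≤ Z.N w := by
    intro w
    have h1 := Z.add_le w (-w)
    have h2 : Z.N (-w) = Z.N w := by
      have := Z.smul_eq (-1) w
      simpa using this
    have h3 : Z.N 0 = 0 := (Z.eq_zero_iff 0).2 rfl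
    rw [add_neg_cancel, h3, h2] at h1
    linarith
  have h1 := Z.uncond (Pi.single i 1) z (by
    intro j
    by_cases h : j = i
    · subst h; simp
    · simp [Pi.single_eq_of_ne h])
  have h2 : (fun j => (Pi.single i 1 : Fin n → ℂ) j * z j) = z i • (Pi.single i 1 : Fin n → ℂ) := by
    ext j
    by_cases h : j = i
    · subst h; simp
    · simp [Pi.single_eq_of_ne h]
  rw [h2, Z.smul_eq] at h1
  have h3 : 0 < Z.N (Pi.single i 1) := by
    refine lt_of_le_of_ne (hnn _) (Ne.symm ?_)
    rw [Ne, Z.eq_zero_iff]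
    simp
  rw [← one_div, le_div_iff₀ h3]
  linarith

lemma lqNorm_le_toLq {n : ℕ} (Z : UncondNorm n) {q : ℝ≥0∞} (z : Fin n → ℂ)
    (hz : z ∈ Z.ball) : lqNorm q z ≤ Z.toLq q := by
  refine le_ciSup (f := fun z : Z.ball => lqNorm q z.1) ?_ ⟨z, hz⟩
  refine ⟨∑ i, (Z.N (Pi.single i 1))⁻¹ +
    (∑ i, (Z.N (Pi.single i 1))⁻¹ ^ q.toReal) ^ (1 / q.toReal), ?_⟩
  · rintro _ ⟨w, rfl⟩
    exact lqNorm_le_of_coord w.1 _ (fun i => coord_le Z w.1 w.2 i)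

/-- Comparison of norms. -/
lemma lq_compare {n : ℕ} (hn : 1 ≤ n) {q : ℝ≥0∞} (z : Fin n → ℂ) :
    lqNormR (min 2 q).toReal z ≤ (n : ℝ) ^ (1 / 2 - (max 2 q)⁻¹.toReal) * lqNorm q z := by
  have hn0 : (0 : ℝ) < n := by exact_mod_cast hn
  rcases le_total q 2 with h | h
  · rw [min_eq_right h, max_eq_left h]
    have hq2 : q ≠ ∞ := ne_top_of_le_ne_top (by simp) h
    have : (1 / 2 - ((2 : ℝ≥0∞)⁻¹).toReal) = 0 := by simp
    rw [this, Real.rpow_zero, one_mul]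
    unfold lqNorm lqNormR
    rw [if_neg hq2]
  · rw [min_eq_left h, max_eq_right h]
    by_cases hi : q = ∞
    · subst hi
      unfold lqNorm lqNormR
      simp only [if_true, ENNReal.inv_top, ENNReal.toReal_zero, sub_zero, ENNReal.toReal_ofNat]
      set M := ⨆ i, ‖z i‖ with hM
      have hM0 : 0 ≤ M := Real.iSup_nonneg fun _ => norm_nonneg _
      have hle : ∀ i, ‖z i‖ ≤ M := fun i => le_ciSup (f := fun i => ‖z i‖) (Set.finite_range _).bddAbove i
      calc (∑ i, ‖z i‖ ^ (2 : ℝ)) ^ (1 / 2 : ℝ) ≤ (∑ i : Fin n, M ^ (2 : ℝ)) ^ (1 / 2 : ℝ) := by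
            refine Real.rpow_le_rpow (Finset.sum_nonneg fun i _ => by positivity) ?_ (by norm_num)
            exact Finset.sum_le_sum fun i _ => Real.rpow_le_rpow (norm_nonneg _) (hle i) (by norm_num)
        _ = _ := by
            rw [Finset.sum_const, Finset.card_univ, Fintype.card_fin, nsmul_eq_mul,
              Real.mul_rpow hn0.le (by positivity), ← Real.rpow_mul hM0]
            norm_num
    · unfold lqNorm lqNormR
      rw [if_neg hi, ENNReal.toReal_inv]
      set t := q.toReal with ht
      have ht2 : 2 ≤ t := by
        have := ENNReal.toReal_mono hi h
        simpa using this
      simp only [ENNReal.toReal_ofNat]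
      have key := Real.rpow_sum_le_const_mul_sum_rpow_of_nonneg (Finset.univ)
        (f := fun i => ‖z i‖ ^ (2 : ℝ)) (p := t / 2) (by linarith) (fun i _ => by positivity)
      have e : ∀ i, (‖z i‖ ^ (2 : ℝ)) ^ (t / 2) = ‖z i‖ ^ t := fun i => by
        rw [← Real.rpow_mul (norm_nonneg _)]; congr 1; ring
      simp only [e, Finset.card_univ, Fintype.card_fin] at key
      have hS : 0 ≤ ∑ i, ‖z i‖ ^ (2 : ℝ) := Finset.sum_nonneg fun i _ => by positivity
      have hT : 0 ≤ ∑ i, ‖z i‖ ^ t := Finset.sum_nonneg fun i _ => by positivity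
      have key2 := Real.rpow_le_rpow (by positivity) key (by positivity : 0 ≤ 1 / t)
      rw [← Real.rpow_mul hS, Real.mul_rpow (by positivity) hT, ← Real.rpow_mul hn0.le] at key2
      have e1 : t / 2 * (1 / t) = 1 / 2 := by field_simp
      have e2 : (t / 2 - 1) * (1 / t) = 1 / 2 - t⁻¹ := by field_simp
      rw [e1, e2] at key2
      exact key2

lemma mono_smul {n m : ℕ} (c : ℂ) (z : Fin n → ℂ) {α : Fin n → ℕ} (h : α ∈ idx n m) :
    mono (fun i => c * z i) α = c ^ m * mono z α := by
  unfold mono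
  simp_rw [mul_pow]
  rw [Finset.prod_mul_distrib, Finset.prod_pow_eq_pow_sum, mem_idx.1 h]

lemma poly_bound {n m : ℕ} (hm : 1 ≤ m) {s : ℝ} (hs : 0 < s) (c : (Fin n → ℕ) → ℂ) (M : ℝ)
    (hM : ∀ z : Fin n → ℂ, ∑ i, ‖z i‖ ^ s ≤ 1 → ‖∑ α ∈ idx n m, mono z α * c α‖ ≤ M)
    (L : ℝ) (z : Fin n → ℂ) (hz : lqNormR s z ≤ L) :
    ‖∑ α ∈ idx n m, mono z α * c α‖ ≤ M * L ^ m := by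
  have hsum : 0 ≤ ∑ i, ‖z i‖ ^ s := Finset.sum_nonneg fun i _ => by positivity
  have hL0 : 0 ≤ L := le_trans (Real.rpow_nonneg hsum _) hz
  rcases hL0.eq_or_lt with h | h
  · have hz0 : z = fun i => (0 : ℂ) * z i := by
      ext i
      have := (norm_le_lqNormR hs z i).trans hz
      rw [← h] at this
      rw [norm_le_zero_iff.1 this]; simp
    have : ∑ α ∈ idx n m, mono z α * c α = 0 := by
      refine Finset.sum_eq_zero fun α hα => ?_
      rw [hz0, mono_smul 0 z hα, zero_pow (by omega)]; simp
    rw [this, ← h, zero_pow (by omega)]; simp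
  · have hLc : (L : ℂ) ≠ 0 := by exact_mod_cast h.ne'
    have hz0 : z = fun i => (L : ℂ) * ((L : ℂ)⁻¹ * z i) := by
      ext i; rw [mul_inv_cancel_left₀ hLc]
    have h1 : ∑ α ∈ idx n m, mono z α * c α =
        (L : ℂ) ^ m * ∑ α ∈ idx n m, mono (fun i => (L : ℂ)⁻¹ * z i) α * c α := by
      rw [Finset.mul_sum]
      refine Finset.sum_congr rfl fun α hα => ?_
      conv_lhs => rw [hz0]
      rw [mono_smul _ _ hα]; ring
    rw [h1, norm_mul, norm_pow, Complex.norm_real, Real.norm_eq_abs, abs_of_pos h, mul_comm]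
    refine mul_le_mul_of_nonneg_right (hM _ ?_) (by positivity)
    have h2 : ∀ i, ‖(L : ℂ)⁻¹ * z i‖ ^ s = (L ^ s)⁻¹ * ‖z i‖ ^ s := by
      intro i
      rw [norm_mul, norm_inv, Complex.norm_real, Real.norm_eq_abs, abs_of_pos h,
        Real.mul_rpow (by positivity) (norm_nonneg _), Real.inv_rpow h.le]
    simp_rw [h2]
    rw [← Finset.mul_sum, inv_mul_le_iff₀ (by positivity), mul_one]
    unfold lqNormR at hz
    have := Real.rpow_le_rpow (Real.rpow_nonneg hsum _) hz hs.le
    rwa [← Real.rpow_mul hsum, one_div_mul_cancel hs.ne', Real.rpow_one] at this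

/-- Consequence of goodness of `r` for a scalar polynomial. -/
lemma goodVec_poly {n m : ℕ} (hm : 1 ≤ m) {H : Type*} [NormedAddCommGroup H]
    [InnerProductSpace ℂ H] [CompleteSpace H] [Nontrivial H] {Ω : Set (Fin n → ℂ)} {p lam : ℝ}
    (hp : 1 ≤ p) (hlam : 1 < lam) {r : Fin n → ℝ} (hr : ∀ i, 0 ≤ r i)
    (hgood : GoodVec Ω p lam (ContinuousLinearMap.id ℂ (H →L[ℂ] H)) (ClsPH Ω) r)
    (ε : (Fin n → ℕ) → ℝ) (hε : ∀ α, ε α = 1 ∨ ε α = -1) (M : ℝ) (hM0 : 0 ≤ M)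
    (hM : ∀ z ∈ Ω, ‖∑ α ∈ idx n m, mono z α * ((ε α * cf α : ℝ) : ℂ)‖ ≤ M) :
    (∑ i, r i) ^ m ≤ lam * M * ((n : ℝ) ^ (1 - 1 / p)) ^ m := by
  classical
  have hp0 : 0 < p := by linarith
  set a : (Fin n → ℕ) → (H →L[ℂ] H) := fun α =>
    if α ∈ idx n m then ((ε α * cf α : ℝ) : ℂ) • (1 : H →L[ℂ] H) else 0 with ha
  set f : (Fin n → ℂ) → (H →L[ℂ] H) := fun z =>
    (∑ α ∈ idx n m, mono z α * ((ε α * cf α : ℝ) : ℂ)) • (1 : H →L[ℂ] H) with hf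
  have hfn : ∀ z ∈ Ω, ‖f z‖ ≤ M := by
    intro z hz
    rw [hf]
    simp only
    rw [norm_smul, norm_one, mul_one]
    exact hM z hz
  have hsupp : ∀ z : Fin n → ℂ, ∀ α ∉ idx n m, mono z α • a α = 0 := by
    intro z α hα
    simp [ha, hα]
  have hcls : ClsPH Ω f a (fun _ => 0) := by
    refine ⟨⟨rfl, fun z _ => ⟨?_, ?_, ?_⟩⟩, M, hfn⟩
    · exact summable_of_ne_finset_zero (s := idx n m) (hsupp z)
    · simp [summable_zero]
    · rw [tsum_eq_sum (s := idx n m) (hsupp z)]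
      simp only [map_zero, smul_zero, tsum_zero, add_zero, hf]
      rw [Finset.sum_smul]
      refine Finset.sum_congr rfl fun α hα => ?_
      simp [ha, hα, smul_smul]
  have h := hgood f a (fun _ => 0) hcls (idx n m)
  have hsup0 : 0 ≤ supNorm Ω f := Real.iSup_nonneg fun _ => norm_nonneg _
  have hsup : supNorm Ω f ≤ M := Real.iSup_le (fun z => hfn z.1 z.2) hM0
  have hmr : ∀ α : Fin n → ℕ, 0 ≤ monoR r α := fun α => Finset.prod_nonneg fun i _ => pow_nonneg (hr i) _
  have hc0 : ∀ α : Fin n → ℕ, 0 ≤ cf α := fun α => zero_le_one.trans (one_le_cf α)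
  have e1 : ∀ α ∈ idx n m, (‖(ContinuousLinearMap.id ℂ (H →L[ℂ] H)) (a α)‖ ^ p +
      ‖(ContinuousLinearMap.id ℂ (H →L[ℂ] H)) ((fun _ => (0 : H →L[ℂ] H)) α)‖ ^ p) * monoR r α ^ p
      = (cf α * monoR r α) ^ p := by
    intro α hα
    have : ‖a α‖ = cf α := by
      simp only [ha, hα, if_true]
      rw [norm_smul, norm_one, mul_one, Complex.norm_real, Real.norm_eq_abs, abs_mul,
        abs_of_nonneg (hc0 α)]
      rcases hε α with h | h <;> simp [h]
    simp only [ContinuousLinearMap.id_apply, norm_zero, this]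
    rw [Real.zero_rpow hp0.ne', add_zero, Real.mul_rpow (hc0 α) (hmr α)]
  rw [Finset.sum_congr rfl e1] at h
  have h2 := Real.rpow_sum_le_const_mul_sum_rpow_of_nonneg (idx n m)
    (f := fun α => cf α * monoR r α) hp (fun α _ => mul_nonneg (hc0 α) (hmr α))
  have e2 : ∑ α ∈ idx n m, cf α * monoR r α = (∑ i, r i) ^ m := sum_cf r
  rw [e2] at h2
  set S := ∑ i, r i with hS
  have hS0 : 0 ≤ S := Finset.sum_nonneg fun i _ => hr i
  have hX : 0 ≤ lam * M * ((n : ℝ) ^ (1 - 1 / p)) ^ m := by positivity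
  rw [← Real.rpow_le_rpow_iff (by positivity) hX hp0]
  refine h2.trans ?_
  calc _ ≤ ((n : ℝ) ^ m) ^ (p - 1) * (lam ^ p * supNorm Ω f ^ p) := by
        refine mul_le_mul ?_ h (Finset.sum_nonneg fun α _ =>
          Real.rpow_nonneg (mul_nonneg (hc0 α) (hmr α)) _) (by positivity)
        exact Real.rpow_le_rpow (by positivity) (card_idx n m) (by linarith)
    _ ≤ ((n : ℝ) ^ m) ^ (p - 1) * (lam ^ p * M ^ p) := by
        have := Real.rpow_le_rpow hsup0 hsup hp0.le
        gcongr
    _ = _ := by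
        rw [Real.mul_rpow (by positivity) (by positivity), Real.mul_rpow (by linarith) hM0]
        have : ((n : ℝ) ^ m) ^ (p - 1) = (((n : ℝ) ^ (1 - 1 / p)) ^ m) ^ p := by
          have hn : (0 : ℝ) ≤ n := by positivity
          rw [← Real.rpow_natCast, ← Real.rpow_natCast, ← Real.rpow_mul hn, ← Real.rpow_mul hn,
            ← Real.rpow_mul hn]
          congr 1; field_simp
        rw [this]; ring

lemma log_bound {n m : ℕ} (hn : 2 ≤ n) (hm : 1 ≤ m) (hmn : m ≤ n) :
    2 + 2 * Real.log (4 * (2 * (2 * m * n ^ m : ℕ) + 1) ^ (2 * n)) ≤ 12 * (n : ℝ) ^ 3 := by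
  have hn' : (2 : ℝ) ≤ n := by exact_mod_cast hn
  have hm' : (1 : ℝ) ≤ m := by exact_mod_cast hm
  have hmn' : (m : ℝ) ≤ n := by exact_mod_cast hmn
  have hnm : (1 : ℝ) ≤ (n : ℝ) ^ m := one_le_pow₀ (by linarith)
  have hlogn : Real.log n ≤ n - 1 := Real.log_le_sub_one_of_pos (by linarith)
  have hlogn0 : 0 ≤ Real.log n := Real.log_nonneg (by linarith)
  have h5 : Real.log 5 ≤ 4 := by
    have := Real.log_le_sub_one_of_pos (by norm_num : (0 : ℝ) < 5); linarith
  have h4 : Real.log 4 ≤ 3 := by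
    have := Real.log_le_sub_one_of_pos (by norm_num : (0 : ℝ) < 4); linarith
  have hlogm : Real.log m ≤ n - 1 := by
    have := Real.log_le_sub_one_of_pos (by linarith : (0 : ℝ) < m); linarith
  push_cast
  have hle : 2 * (2 * (m : ℝ) * n ^ m) + 1 ≤ 5 * m * n ^ m := by nlinarith
  have hl : Real.log (2 * (2 * (m : ℝ) * n ^ m) + 1) ≤ 4 + (n - 1) + n * (n - 1) := by
    refine (Real.log_le_log (by positivity) hle).trans ?_
    rw [Real.log_mul (by positivity) (by positivity), Real.log_mul (by norm_num) (by positivity),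
      Real.log_pow]
    have : (m : ℝ) * Real.log n ≤ n * (n - 1) := mul_le_mul hmn' hlogn hlogn0 (by linarith)
    linarith
  rw [Real.log_mul (by norm_num) (by positivity), Real.log_pow]
  push_cast
  have : 2 * (n : ℝ) * Real.log (2 * (2 * (m : ℝ) * n ^ m) + 1) ≤
      2 * n * (4 + (n - 1) + n * (n - 1)) := by gcongr
  nlinarith [mul_nonneg (by linarith : (0:ℝ) ≤ n) (mul_nonneg (by linarith : (0:ℝ) ≤ n - 2) (by linarith : (0:ℝ) ≤ n - 2)), mul_nonneg (by linarith : (0:ℝ) ≤ n) (by linarith : (0:ℝ) ≤ n - 2)]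

lemma apradius_trivial {n : ℕ} (hn : 1 ≤ n) {H : Type*} [NormedAddCommGroup H]
    [InnerProductSpace ℂ H] [CompleteSpace H] [Subsingleton H] (Ω : Set (Fin n → ℂ)) {p lam : ℝ}
    (hp : 1 ≤ p) (hlam : 1 < lam) :
    APradius Ω p lam (ContinuousLinearMap.id ℂ (H →L[ℂ] H)) = 0 := by
  unfold APradius APgen
  apply Real.sSup_of_not_bddAbove
  rintro ⟨B, hB⟩
  have hn0 : (0 : ℝ) < n := by exact_mod_cast hn
  have : (|B| + 1) ≤ B := by
    apply hB
    refine ⟨fun _ => |B| + 1, fun _ => by positivity, ?_, ?_⟩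
    · intro f a b _ F
      have hsup0 : 0 ≤ supNorm Ω f := Real.iSup_nonneg fun _ => norm_nonneg _
      have : ∀ x : H →L[ℂ] H, x = 0 := fun x => Subsingleton.elim _ _
      have e : ∑ α ∈ F, (‖(ContinuousLinearMap.id ℂ (H →L[ℂ] H)) (a α)‖ ^ p +
        ‖(ContinuousLinearMap.id ℂ (H →L[ℂ] H)) (b α)‖ ^ p) * monoR (fun _ => |B| + 1) α ^ p = 0 := by
        refine Finset.sum_eq_zero fun α _ => ?_
        rw [this (a α), this (b α)]
        simp [Real.zero_rpow (by linarith : p ≠ 0)]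
      rw [e]
      positivity
    · simp; field_simp
  linarith [le_abs_self B]

end ArithBohr
namespace ArithBohr

universe u

/-- Theorem `thm-1.2-atm`, upper bound: there is `d > 0` such that for
every finite-dimensional `B(H)`, `λ > 1`, `1 ≤ p < ∞`, `1 ≤ q ≤ ∞`, `n ≥ 2` and `Z`:
`AP_λ(B_Z,p,X) ≤ d λ^{1/log n} ‖Id:Z→ℓ^n_q‖ (log n)^{1-1/min{2,q}} n^{-(1/p+1/max{2,q}-1/2)}`. -/
theorem statement7 :
    ∃ d : ℝ, 0 < d ∧
      ∀ (H : Type u) [NormedAddCommGroup H] [InnerProductSpace ℂ H] [CompleteSpace H]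
        [FiniteDimensional ℂ H],
        ∀ lam : ℝ, 1 < lam → ∀ p : ℝ, 1 ≤ p → ∀ q : ℝ≥0∞, 1 ≤ q →
          ∀ n : ℕ, 2 ≤ n → ∀ Z : UncondNorm n,
            APradius Z.ball p lam (ContinuousLinearMap.id ℂ (H →L[ℂ] H)) ≤
              d * lam ^ (1 / Real.log n) * Z.toLq q *
                Real.log n ^ (1 - (min 2 q)⁻¹.toReal) *
                (n : ℝ) ^ (-(1 / p + (max 2 q)⁻¹.toReal - 1 / 2)) := by
  refine ⟨36 * Real.exp 3, by positivity, ?_⟩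
  intro H _ _ _ _ lam hlam p hp q hq n hn Z
  have hn' : (2 : ℝ) ≤ n := by exact_mod_cast hn
  have hn0 : (0 : ℝ) < n := by linarith
  have hlog2 : (0.69 : ℝ) ≤ Real.log n := by
    have h1 := Real.log_two_gt_d9
    have h2 := Real.log_le_log (by norm_num) hn'
    linarith
  have hlog0 : 0 < Real.log n := by linarith
  have hL0 := toLq_nonneg Z q
  have hlam0 : 0 < lam := by linarith
  rcases subsingleton_or_nontrivial H with hH | hH
  · rw [apradius_trivial (by omega) Z.ball hp hlam]
    positivity
  unfold APradius APgen
  refine Real.sSup_le ?_ (by positivity)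
  rintro _ ⟨r, hr, hgood, rfl⟩
  set s : ℝ := (min 2 q).toReal with hs
  have hmin : min 2 q ≠ ∞ := ne_top_of_le_ne_top (by simp) (min_le_left 2 q)
  have hs1 : 1 ≤ s := by
    have := ENNReal.toReal_mono hmin (le_min (by norm_num : (1 : ℝ≥0∞) ≤ 2) hq)
    simpa using this
  have hs2 : s ≤ 2 := by
    have := ENNReal.toReal_mono (by simp) (min_le_left 2 q)
    simpa using this
  have hs0 : 0 < s := by linarith
  rw [ENNReal.toReal_inv (min 2 q), ← hs, ← one_div s]
  have hθ0 : 0 ≤ 1 - 1 / s := by rw [sub_nonneg, div_le_one hs0]; exact hs1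
  have hθ1 : 1 - 1 / s ≤ 1 := by
    have : 0 ≤ 1 / s := by positivity
    linarith
  set κ : ℝ := (max 2 q)⁻¹.toReal with hκ
  set m : ℕ := ⌈Real.log n⌉₊ with hm
  have hm1 : 1 ≤ m := Nat.one_le_iff_ne_zero.2 (Nat.ceil_pos.2 hlog0).ne'
  have hmlog : Real.log n ≤ m := Nat.le_ceil _
  have hmlog2 : (m : ℝ) ≤ 3 * Real.log n := by
    have := Nat.ceil_lt_add_one hlog0.le
    linarith
  have hmn : m ≤ n := by
    rw [hm, Nat.ceil_le]
    have := Real.log_le_sub_one_of_pos hn0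
    linarith
  obtain ⟨ε, hε, hpoly⟩ := exists_poly (n := n) (m := m) (by omega) hm1 hs1 hs2
  set L : ℝ := (n : ℝ) ^ (1 / 2 - κ) * Z.toLq q with hL
  have hLn : 0 ≤ L := by positivity
  set σ : ℝ := (m.factorial : ℝ) ^ (1 - 1 / s) with hσ
  have hσ0 : 0 < σ := by positivity
  have hlb := log_bound hn hm1 hmn
  have hball : ∀ z ∈ Z.ball, ‖∑ α ∈ idx n m, mono z α * ((ε α * cf α : ℝ) : ℂ)‖ ≤
      σ * (12 * (n : ℝ) ^ 3) * L ^ m := by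
    intro z hz
    refine poly_bound hm1 hs0 _ _ (fun w hw => (hpoly w hw).trans ?_) L z ?_
    · exact mul_le_mul_of_nonneg_left hlb hσ0.le
    · refine (lq_compare (by omega) z).trans ?_
      exact mul_le_mul_of_nonneg_left (lqNorm_le_toLq Z z hz) (by positivity)
  have hmain := goodVec_poly hm1 hp hlam hr hgood ε hε _ (by positivity) hball
  set S := ∑ i, r i with hS
  set T : ℝ := lam ^ (1 / Real.log n) * (3 * Real.log n) ^ (1 - 1 / s) * (12 * Real.exp 3) * L *
    (n : ℝ) ^ (1 - 1 / p) with hT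
  have hT0 : 0 ≤ T := by positivity
  have hST : S ≤ T := by
    refine le_of_pow_le_pow_left₀ (by omega : m ≠ 0) hT0 (hmain.trans ?_)
    have b1 : lam ≤ (lam ^ (1 / Real.log n)) ^ m := by
      rw [← Real.rpow_natCast, ← Real.rpow_mul hlam0.le]
      conv_lhs => rw [← Real.rpow_one lam]
      refine Real.rpow_le_rpow_of_exponent_le hlam.le ?_
      rw [one_div_mul_eq_div, le_div_iff₀ hlog0]; linarith
    have b2 : σ ≤ ((3 * Real.log n) ^ (1 - 1 / s)) ^ m := by
      have : (m.factorial : ℝ) ≤ (3 * Real.log n) ^ m := by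
        calc (m.factorial : ℝ) ≤ (m : ℝ) ^ m := by exact_mod_cast Nat.factorial_le_pow m
          _ ≤ _ := by gcongr
      calc σ ≤ ((3 * Real.log n) ^ m) ^ (1 - 1 / s) :=
            Real.rpow_le_rpow (by positivity) this hθ0
        _ = _ := by
            rw [← Real.rpow_natCast, ← Real.rpow_natCast, ← Real.rpow_mul (by positivity),
              ← Real.rpow_mul (by positivity), mul_comm (m : ℝ)]
    have b3 : 12 * (n : ℝ) ^ 3 ≤ (12 * Real.exp 3) ^ m := by
      rw [mul_pow]
      have c1 : (12 : ℝ) ≤ 12 ^ m := le_self_pow₀ (by norm_num) (by omega)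
      have c2 : (n : ℝ) ^ 3 ≤ Real.exp 3 ^ m := by
        rw [← Real.exp_nat_mul]
        calc (n : ℝ) ^ 3 = Real.exp (3 * Real.log n) := by
              rw [show (3 : ℝ) * Real.log n = ((3 : ℕ) : ℝ) * Real.log n by norm_num,
                Real.exp_nat_mul, Real.exp_log hn0]
          _ ≤ _ := Real.exp_le_exp.2 (by linarith)
      exact mul_le_mul c1 c2 (by positivity) (by positivity)
    calc lam * (σ * (12 * (n : ℝ) ^ 3) * L ^ m) * ((n : ℝ) ^ (1 - 1 / p)) ^ m
        ≤ (lam ^ (1 / Real.log n)) ^ m * (((3 * Real.log n) ^ (1 - 1 / s)) ^ m *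
          (12 * Real.exp 3) ^ m * L ^ m) * ((n : ℝ) ^ (1 - 1 / p)) ^ m := by
          gcongr
      _ = T ^ m := by rw [hT]; ring
  have b4 : (3 * Real.log n) ^ (1 - 1 / s) ≤ 3 * Real.log n ^ (1 - 1 / s) := by
    rw [Real.mul_rpow (by norm_num) hlog0.le]
    refine mul_le_mul_of_nonneg_right ?_ (by positivity)
    calc (3 : ℝ) ^ (1 - 1 / s) ≤ 3 ^ (1 : ℝ) :=
          Real.rpow_le_rpow_of_exponent_le (by norm_num) hθ1
      _ = 3 := Real.rpow_one 3
  rw [div_le_iff₀ hn0]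
  refine hST.trans ?_
  have e : (n : ℝ) ^ (1 / 2 - κ) * (n : ℝ) ^ (1 - 1 / p) =
      (n : ℝ) ^ (-(1 / p + κ - 1 / 2)) * n := by
    rw [← Real.rpow_add hn0, ← Real.rpow_add_one hn0.ne']; congr 1; ring
  calc T ≤ lam ^ (1 / Real.log n) * (3 * Real.log n ^ (1 - 1 / s)) * (12 * Real.exp 3) * L *
        (n : ℝ) ^ (1 - 1 / p) := by rw [hT]; gcongr
    _ = 36 * Real.exp 3 * lam ^ (1 / Real.log n) * Z.toLq q * Real.log n ^ (1 - 1 / s) *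
        ((n : ℝ) ^ (1 / 2 - κ) * (n : ℝ) ^ (1 - 1 / p)) := by rw [hL]; ring
    _ = _ := by rw [e]; ring

end ArithBohr
end
end

section
/- Let H be a complex Hilbert space, Y a complex Banach space, U : B(H) → Y a non-null bounded linear operator with ‖U‖ < λ, 1 ≤ p < ∞ and 1 ≤ q ≤ ∞. Then for every n ∈ ℕ: R_λ(𝔻,p,U)/n ≤ AP_λ(B_{ℓ^n_q},p,U) ≤ R_λ(𝔻,p,U)/n^{1/p + 1/q − 1}. -/
open scoped BigOperators ENNReal NNReal Pointwise
open Finset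

noncomputable section

namespace ArithBohr

section Helpers

lemma prod_single {R : Type*} [CommSemiring R] {n : ℕ} (i0 : Fin n) (w : R) (m : ℕ) :
    ∏ i, (Pi.single i0 w : Fin n → R) i ^ (Pi.single i0 m : Fin n → ℕ) i = w ^ m := by
  rw [Finset.prod_eq_single i0]
  · simp
  · intro j _ hj
    simp [hj]
  · simp

lemma prod_single_zero {R : Type*} [CommSemiring R] {n : ℕ} (i0 : Fin n) (w : R)
    (α : Fin n → ℕ) (h : α ∉ Set.range (fun m : ℕ => (Pi.single i0 m : Fin n → ℕ))) :
    ∏ i, (Pi.single i0 w : Fin n → R) i ^ α i = 0 := by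
  have : ∃ j, j ≠ i0 ∧ α j ≠ 0 := by
    by_contra hcon
    push Not at hcon
    apply h
    refine ⟨α i0, ?_⟩
    funext j
    by_cases hj : j = i0
    · subst hj; simp
    · simp [hj, hcon j hj]
  obtain ⟨j, hj, hα⟩ := this
  apply Finset.prod_eq_zero (Finset.mem_univ j)
  simp [hj, hα]

lemma single_inj {n : ℕ} (i0 : Fin n) :
    Function.Injective (fun m : ℕ => (Pi.single i0 m : Fin n → ℕ)) := by
  intro m m' h
  simpa using congrFun h i0

lemma lqNorm_single {n : ℕ} (q : ℝ≥0∞) (hq : 1 ≤ q) (i0 : Fin n) (w : ℂ) :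
    lqNorm q (Pi.single i0 w : Fin n → ℂ) = ‖w‖ := by
  unfold lqNorm
  split_ifs with h
  · apply le_antisymm
    · haveI : Nonempty (Fin n) := ⟨i0⟩
      apply ciSup_le
      intro i
      by_cases hi : i = i0
      · subst hi; simp
      · simp [hi]
    · have := le_ciSup (f := fun i => ‖(Pi.single i0 w : Fin n → ℂ) i‖)
        (Set.finite_range _).bddAbove i0
      simpa using this
  · have hq0 : 0 < q.toReal := ENNReal.toReal_pos (by positivity) h
    rw [Finset.sum_eq_single i0]
    · simp only [Pi.single_eq_same]
      rw [one_div, Real.rpow_rpow_inv (norm_nonneg _) hq0.ne']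
    · intro j _ hj
      simp [hj, Real.zero_rpow hq0.ne']
    · simp

/-- Bound of the scaled `ℓ_1` norm by the `ℓ_q` norm. -/
lemma sum_lt_of_mem {n : ℕ} (hn : 0 < n) (q : ℝ≥0∞) (hq : 1 ≤ q) (z : Fin n → ℂ)
    (hz : z ∈ lqBall n q) :
    (n : ℝ) ^ (q⁻¹.toReal - 1) * ∑ i, ‖z i‖ < 1 := by
  have hn' : (0 : ℝ) < n := by exact_mod_cast hn
  haveI : Nonempty (Fin n) := ⟨⟨0, hn⟩⟩
  unfold lqBall lqNorm at hz
  simp only [Set.mem_setOf_eq] at hz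
  split_ifs at hz with h
  · subst h
    have h1 : ∀ i, ‖z i‖ < 1 := fun i =>
      lt_of_le_of_lt (le_ciSup (f := fun i => ‖z i‖) (Set.finite_range _).bddAbove i) hz
    have h2 : ∑ i, ‖z i‖ < ∑ _i : Fin n, (1 : ℝ) :=
      Finset.sum_lt_sum_of_nonempty Finset.univ_nonempty (fun i _ => h1 i)
    simp only [ENNReal.inv_top, ENNReal.toReal_zero, zero_sub, Real.rpow_neg_one]
    rw [inv_mul_lt_iff₀ hn']
    simpa using h2
  · have hq1 : 1 ≤ q.toReal := by
      rw [← ENNReal.toReal_one]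
      exact (ENNReal.toReal_le_toReal ENNReal.one_ne_top h).2 hq
    have hq0 : 0 < q.toReal := by linarith
    have key := Real.rpow_sum_le_const_mul_sum_rpow (Finset.univ) (fun i => ‖z i‖) hq1
    simp only [abs_norm, Finset.card_univ, Fintype.card_fin] at key
    have hS : 0 ≤ ∑ i, ‖z i‖ := Finset.sum_nonneg fun i _ => norm_nonneg _
    have hT : 0 ≤ ∑ i, ‖z i‖ ^ q.toReal := Finset.sum_nonneg fun i _ => by positivity
    have h2 : ∑ i, ‖z i‖ ≤
        (n : ℝ) ^ (1 - q⁻¹.toReal) * (∑ i, ‖z i‖ ^ q.toReal) ^ (1 / q.toReal) := by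
      have := Real.rpow_le_rpow (by positivity) key (z := 1 / q.toReal) (by positivity)
      rw [one_div, Real.rpow_rpow_inv hS hq0.ne', Real.mul_rpow (by positivity) hT,
        ← Real.rpow_mul hn'.le] at this
      rw [ENNReal.toReal_inv, one_div]
      convert this using 3
      field_simp
    calc (n : ℝ) ^ (q⁻¹.toReal - 1) * ∑ i, ‖z i‖
        ≤ (n : ℝ) ^ (q⁻¹.toReal - 1) * ((n : ℝ) ^ (1 - q⁻¹.toReal) *
          (∑ i, ‖z i‖ ^ q.toReal) ^ (1 / q.toReal)) := by gcongr
      _ = (∑ i, ‖z i‖ ^ q.toReal) ^ (1 / q.toReal) := by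
          rw [← mul_assoc, ← Real.rpow_add hn']; simp
      _ < 1 := hz

/-- Grouping by degree. -/
lemma summable_by_degree {n : ℕ} {E : Type*} [NormedAddCommGroup E] [CompleteSpace E]
    (g : (Fin n → ℕ) → E) (h : ℕ → ℝ) (hh : Summable h)
    (hg : ∀ m, ∑ α ∈ Finset.piAntidiag Finset.univ m, ‖g α‖ = h m) :
    Summable g ∧ ∑' α, g α = ∑' m, ∑ α ∈ Finset.piAntidiag Finset.univ m, g α := by
  have hpos : ∀ m, 0 ≤ h m := fun m => by
    rw [← hg]; exact Finset.sum_nonneg fun _ _ => norm_nonneg _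
  have hs : Summable g := by
    apply Summable.of_norm
    apply summable_of_sum_le (c := ∑' m, h m) (fun _ => norm_nonneg _)
    intro F
    classical
    rw [← Finset.sum_fiberwise_of_maps_to (t := F.image fun α => ∑ i, α i)
      (g := fun α => ∑ i, α i) (fun α hα => Finset.mem_image_of_mem _ hα)]
    refine le_trans ?_ (hh.sum_le_tsum (F.image fun α => ∑ i, α i) (fun m _ => hpos m))
    apply Finset.sum_le_sum
    intro m _
    rw [← hg m]
    apply Finset.sum_le_sum_of_subset_of_nonneg
    · intro α hα
      simp only [Finset.mem_filter] at hα
      simp [Finset.mem_piAntidiag, hα.2]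
    · intros; positivity
  refine ⟨hs, ?_⟩
  have := (hs.hasSum.tsum_fiberwise (fun α : Fin n → ℕ => ∑ i, α i)).tsum_eq
  rw [← this]
  congr 1
  funext m
  rw [← Finset.tsum_subtype]
  have hset : (fun α : Fin n → ℕ => ∑ i, α i) ⁻¹' {m} =
      ((Finset.piAntidiag Finset.univ m : Finset (Fin n → ℕ)) : Set (Fin n → ℕ)) := by
    ext α; simp [Finset.mem_piAntidiag]
  rw [hset]
  rfl

/-- The scalar coefficient of `z ^ α` in `(c * ∑ z_i) ^ |α|`. -/
def kc {n : ℕ} (c : ℝ) (α : Fin n → ℕ) : ℝ :=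
  (Nat.multinomial Finset.univ α : ℝ) * c ^ (∑ i, α i)

lemma kc_nonneg {n : ℕ} {c : ℝ} (hc : 0 ≤ c) (α : Fin n → ℕ) : 0 ≤ kc c α := by
  unfold kc; positivity

lemma sum_kc {n : ℕ} (c : ℝ) (w : Fin n → ℂ) (m : ℕ) :
    ∑ α ∈ Finset.piAntidiag Finset.univ m, mono w α * (kc c α : ℂ) = ((c : ℂ) * ∑ i, w i) ^ m := by
  rw [mul_pow, Finset.sum_pow_eq_sum_piAntidiag, Finset.mul_sum]
  apply Finset.sum_congr rfl
  intro α hα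
  have : ∑ i, α i = m := (Finset.mem_piAntidiag.1 hα).1
  unfold mono kc
  rw [this]
  push_cast
  ring

lemma sum_kcR {n : ℕ} (c : ℝ) (w : Fin n → ℝ) (m : ℕ) :
    ∑ α ∈ Finset.piAntidiag Finset.univ m, monoR w α * kc c α = (c * ∑ i, w i) ^ m := by
  rw [mul_pow, Finset.sum_pow_eq_sum_piAntidiag, Finset.mul_sum]
  apply Finset.sum_congr rfl
  intro α hα
  have : ∑ i, α i = m := (Finset.mem_piAntidiag.1 hα).1
  unfold monoR kc
  rw [this]
  ring

lemma norm_mono_s13 {n : ℕ} (w : Fin n → ℂ) (α : Fin n → ℕ) :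
    ‖mono w α‖ = monoR (fun i => ‖w i‖) α := by
  simp [mono, monoR]

lemma abs_summable {E : Type*} [NormedAddCommGroup E] [NormedSpace ℂ E]
    (a : ℕ → E) (ha : ∀ z : ℂ, ‖z‖ < 1 → Summable (fun m => z ^ m • a m))
    (ρ : ℝ) (h0 : 0 ≤ ρ) (h1 : ρ < 1) : Summable (fun m => ρ ^ m * ‖a m‖) := by
  obtain ⟨s, hs1, hs2⟩ := exists_between h1
  have hs0 : 0 < s := by linarith
  have h := ha (s : ℂ) (by simpa [abs_of_pos hs0] using hs2)
  have hb := h.tendsto_atTop_zero.norm.bddAbove_range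
  obtain ⟨M, hM⟩ := hb
  have hM' : ∀ m, s ^ m * ‖a m‖ ≤ M := by
    intro m
    have := hM ⟨m, rfl⟩
    simpa [norm_smul, abs_of_pos hs0] using this
  refine Summable.of_nonneg_of_le (fun m => by positivity) (fun m => ?_)
    ((summable_geometric_of_lt_one (r := ρ / s) (by positivity)
      ((div_lt_one hs0).2 hs1)).mul_right M)
  calc ρ ^ m * ‖a m‖ = (ρ / s) ^ m * (s ^ m * ‖a m‖) := by
        rw [div_pow]; field_simp
    _ ≤ (ρ / s) ^ m * M := by
        apply mul_le_mul_of_nonneg_left (hM' m); positivity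

lemma expand {n : ℕ} {E : Type*} [NormedAddCommGroup E] [NormedSpace ℂ E] [CompleteSpace E]
    (a : ℕ → E) (ha : ∀ z : ℂ, ‖z‖ < 1 → Summable (fun m => z ^ m • a m))
    (c : ℝ) (hc : 0 ≤ c) (w : Fin n → ℂ) (hw : c * ∑ i, ‖w i‖ < 1) :
    Summable (fun α => mono w α • ((kc c α : ℂ) • a (∑ i, α i))) ∧
    ∑' α, mono w α • ((kc c α : ℂ) • a (∑ i, α i)) =
      ∑' m, ((c : ℂ) * ∑ i, w i) ^ m • a m := by
  have hρ : 0 ≤ c * ∑ i, ‖w i‖ := mul_nonneg hc (Finset.sum_nonneg fun i _ => norm_nonneg _)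
  have := summable_by_degree (fun α => mono w α • ((kc c α : ℂ) • a (∑ i, α i))) _
    (abs_summable a ha _ hρ hw) (by
      intro m
      rw [← sum_kcR, Finset.sum_mul]
      apply Finset.sum_congr rfl
      intro α hα
      have : ∑ i, α i = m := (Finset.mem_piAntidiag.1 hα).1
      rw [norm_smul, norm_smul, norm_mono_s13, this, Complex.norm_real,
        Real.norm_of_nonneg (kc_nonneg hc α)]
      ring)
  refine ⟨this.1, this.2.trans ?_⟩
  congr 1
  funext m
  rw [← sum_kc, Finset.sum_smul]
  apply Finset.sum_congr rfl
  intro α hα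
  have : ∑ i, α i = m := (Finset.mem_piAntidiag.1 hα).1
  rw [this, smul_smul]

variable {H : Type*} [NormedAddCommGroup H] [InnerProductSpace ℂ H] [CompleteSpace H]
variable {Y : Type*} [NormedAddCommGroup Y] [NormedSpace ℂ Y]

/-- Goodness of a one-dimensional radius. -/
def GoodR (p lam : ℝ) (U : (H →L[ℂ] H) →L[ℂ] Y) (r : ℝ) : Prop :=
  ∀ f a b, RepresentsDisk f a b → IsBoundedOnDisk f →
    ∀ F : Finset ℕ, ∑ m ∈ F, (‖U (a m)‖ ^ p + ‖U (b m)‖ ^ p) * r ^ ((m : ℝ) * p)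
      ≤ lam ^ p * supNormDisk f ^ p

lemma supNormDisk_nonneg {E : Type*} [NormedAddCommGroup E] (f : ℂ → E) : 0 ≤ supNormDisk f :=
  Real.iSup_nonneg fun _ => norm_nonneg _

lemma le_supNormDisk {E : Type*} [NormedAddCommGroup E] {f : ℂ → E} (hf : IsBoundedOnDisk f)
    {z : ℂ} (hz : ‖z‖ < 1) : ‖f z‖ ≤ supNormDisk f := by
  obtain ⟨M, hM⟩ := hf
  refine le_ciSup (f := fun z : {w : ℂ // ‖w‖ < 1} => ‖f z.1‖) ?_ ⟨z, hz⟩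
  refine ⟨M, ?_⟩
  rintro _ ⟨x, rfl⟩
  exact hM _ x.2

lemma supNorm_nonneg {n : ℕ} {E : Type*} [NormedAddCommGroup E] (Ω : Set (Fin n → ℂ))
    (f : (Fin n → ℂ) → E) : 0 ≤ supNorm Ω f :=
  Real.iSup_nonneg fun _ => norm_nonneg _

lemma le_supNorm {n : ℕ} {E : Type*} [NormedAddCommGroup E] {Ω : Set (Fin n → ℂ)}
    {f : (Fin n → ℂ) → E} (hf : IsBoundedOn Ω f)
    {z : Fin n → ℂ} (hz : z ∈ Ω) : ‖f z‖ ≤ supNorm Ω f := by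
  obtain ⟨M, hM⟩ := hf
  refine le_ciSup (f := fun z : Ω => ‖f z.1‖) ?_ ⟨z, hz⟩
  refine ⟨M, ?_⟩
  rintro _ ⟨x, rfl⟩
  exact hM _ x.2

lemma GoodR_bdd (U : (H →L[ℂ] H) →L[ℂ] Y) (hU : U ≠ 0) (p lam : ℝ) (hp : 1 ≤ p)
    (hlam : 1 ≤ lam) : BddAbove {r : ℝ | 0 ≤ r ∧ GoodR p lam U r} := by
  obtain ⟨T, hT⟩ : ∃ T, U T ≠ 0 := by
    by_contra h
    push Not at h
    exact hU (ContinuousLinearMap.ext h)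
  have hUT : 0 < ‖U T‖ := norm_pos_iff.2 hT
  have hp0 : 0 < p := by linarith
  refine ⟨lam * ‖T‖ / ‖U T‖, ?_⟩
  rintro r ⟨hr, hg⟩
  have hb : ∀ z : ℂ, ‖z‖ < 1 → ‖z • T‖ ≤ ‖T‖ := by
    intro z hz
    rw [norm_smul]
    exact mul_le_of_le_one_left (norm_nonneg _) hz.le
  have h := hg (fun z => z • T) (Pi.single 1 T) 0 (by
    refine ⟨rfl, fun z _ => ?_⟩
    have hz0 : ∀ m ∉ ({1} : Finset ℕ),
        z ^ m • (Pi.single 1 T : ℕ → (H →L[ℂ] H)) m = 0 := by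
      intro m hm
      simp only [Finset.mem_singleton] at hm
      simp [hm]
    refine ⟨summable_of_ne_finset_zero hz0, ?_, ?_⟩
    · simpa using summable_zero
    · rw [tsum_eq_sum hz0]
      simp) ⟨‖T‖, hb⟩ {1}
  have hs : supNormDisk (fun z : ℂ => z • T) ≤ ‖T‖ :=
    Real.iSup_le (fun z => hb _ z.2) (norm_nonneg _)
  have h2 : (‖U T‖ * r) ^ p ≤ (lam * ‖T‖) ^ p := by
    rw [Real.mul_rpow hUT.le hr, Real.mul_rpow (by linarith) (norm_nonneg _)]
    have h3 : supNormDisk (fun z : ℂ => z • T) ^ p ≤ ‖T‖ ^ p :=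
      Real.rpow_le_rpow (supNormDisk_nonneg _) hs hp0.le
    have h4 : lam ^ p * supNormDisk (fun z : ℂ => z • T) ^ p ≤ lam ^ p * ‖T‖ ^ p :=
      mul_le_mul_of_nonneg_left h3 (Real.rpow_nonneg (by linarith) _)
    refine le_trans ?_ (h.trans h4)
    simp [Real.zero_rpow hp0.ne']
  have h5 := (Real.rpow_le_rpow_iff (by positivity)
    (mul_nonneg (by linarith) (norm_nonneg _)) hp0).1 h2
  rw [le_div_iff₀ hUT]
  linarith

lemma GoodR_zero (U : (H →L[ℂ] H) →L[ℂ] Y) (p lam : ℝ) (hp : 1 ≤ p)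
    (hUlam : ‖U‖ < lam) : GoodR p lam U 0 := by
  intro f a b hab hf F
  have hp0 : 0 < p := by linarith
  have hlam0 : 0 ≤ lam := (norm_nonneg U).trans hUlam.le
  have hz : ∀ m ∈ F, m ≠ 0 →
      (‖U (a m)‖ ^ p + ‖U (b m)‖ ^ p) * (0 : ℝ) ^ ((m : ℝ) * p) = 0 := by
    intro m _ hm
    rw [Real.zero_rpow, mul_zero]
    have : (m : ℝ) ≠ 0 := by exact_mod_cast hm
    positivity
  have hRHS : 0 ≤ lam ^ p * supNormDisk f ^ p :=
    mul_nonneg (Real.rpow_nonneg hlam0 _) (Real.rpow_nonneg (supNormDisk_nonneg _) _)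
  by_cases h0 : 0 ∈ F
  · rw [Finset.sum_eq_single_of_mem 0 h0 hz]
    have hf0 : f 0 = a 0 := by
      rw [(hab.2 0 (by simp)).2.2, tsum_eq_single 0, tsum_eq_single 0]
      · simp [hab.1]
      · intro m hm; simp [hm]
      · intro m hm; simp [hm]
    have h1 : ‖a 0‖ ≤ supNormDisk f := by
      rw [← hf0]; exact le_supNormDisk hf (by simp)
    have h2 : ‖U (a 0)‖ ≤ lam * supNormDisk f :=
      (U.le_opNorm _).trans (mul_le_mul hUlam.le h1 (norm_nonneg _) hlam0)
    have h3 := Real.rpow_le_rpow (norm_nonneg _) h2 hp0.le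
    rw [Real.mul_rpow hlam0 (supNormDisk_nonneg _)] at h3
    simpa [hab.1, Real.zero_rpow hp0.ne'] using h3
  · rw [Finset.sum_eq_zero]
    · exact hRHS
    · intro m hm
      exact hz m hm (fun h => h0 (h ▸ hm))

lemma GoodVec_single {n : ℕ} (U : (H →L[ℂ] H) →L[ℂ] Y) (p lam : ℝ) (hp : 1 ≤ p)
    (hlam : 1 ≤ lam) (q : ℝ≥0∞) (hq : 1 ≤ q) (i0 : Fin n) (r : ℝ) (hr : 0 ≤ r)
    (hg : GoodR p lam U r) :
    GoodVec (lqBall n q) p lam U (ClsPH (lqBall n q)) (Pi.single i0 r) := by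
  rintro f a b ⟨⟨hb0, hrep⟩, hbd⟩ F
  have hp0 : 0 < p := by linarith
  have hmem : ∀ w : ℂ, ‖w‖ < 1 → (Pi.single i0 w : Fin n → ℂ) ∈ lqBall n q := by
    intro w hw
    change lqNorm q _ < 1
    rwa [lqNorm_single q hq]
  have hinj := single_inj i0
  set e : ℕ → (Fin n → ℕ) := fun m => Pi.single i0 m with he
  set g : ℂ → (H →L[ℂ] H) := fun w => f (Pi.single i0 w) with hgdef
  have hm : ∀ (w : ℂ) (m : ℕ), mono (Pi.single i0 w : Fin n → ℂ) (e m) = w ^ m :=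
    fun w m => prod_single i0 w m
  have hm0 : ∀ (w : ℂ) (α), α ∉ Set.range e → mono (Pi.single i0 w : Fin n → ℂ) α = 0 :=
    fun w α h => prod_single_zero i0 w α h
  have hstar : ∀ w : ℂ, star (Pi.single i0 w : Fin n → ℂ) =
      Pi.single i0 (starRingEnd ℂ w) := by
    intro w
    funext j
    by_cases hj : j = i0
    · subst hj; simp
    · simp [hj]
  have hgb : IsBoundedOnDisk g := by
    obtain ⟨M, hM⟩ := hbd
    exact ⟨M, fun z hz => hM _ (hmem z hz)⟩
  have hgrep : RepresentsDisk g (fun m => a (e m)) (fun m => b (e m)) := by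
    refine ⟨by simpa [he] using hb0, fun z hz => ?_⟩
    obtain ⟨h1, h2, h3⟩ := hrep _ (hmem z hz)
    rw [hstar] at h2 h3
    have z1 : ∀ α ∉ Set.range e, mono (Pi.single i0 z : Fin n → ℂ) α • a α = 0 :=
      fun α h => by rw [hm0 _ _ h, zero_smul]
    have z2 : ∀ α ∉ Set.range e, mono (Pi.single i0 (starRingEnd ℂ z) : Fin n → ℂ) α •
        (ContinuousLinearMap.adjoint (b α)) = 0 :=
      fun α h => by rw [hm0 _ _ h, zero_smul]
    refine ⟨?_, ?_, ?_⟩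
    · have := (hinj.summable_iff z1).2 h1
      refine this.congr fun m => ?_
      simp only [Function.comp, hm]
    · have := (hinj.summable_iff z2).2 h2
      refine this.congr fun m => ?_
      simp only [Function.comp, hm]
    · change f _ = _
      rw [h3, ← hinj.tsum_eq (Function.support_subset_iff'.2 z1),
        ← hinj.tsum_eq (Function.support_subset_iff'.2 z2)]
      simp only [hm]
  have hle : supNormDisk g ≤ supNorm (lqBall n q) f :=
    Real.iSup_le (fun z => le_supNorm hbd (hmem _ z.2)) (supNorm_nonneg _ _)
  have hmain := hg g _ _ hgrep hgb (F.preimage e hinj.injOn)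
  have hR0 : ∀ α ∈ F, α ∉ Set.range e →
      (‖U (a α)‖ ^ p + ‖U (b α)‖ ^ p) * monoR (Pi.single i0 r) α ^ p = 0 := by
    intro α _ h
    have : monoR (Pi.single i0 r) α = 0 := prod_single_zero i0 r α h
    rw [this, Real.zero_rpow hp0.ne', mul_zero]
  rw [← Finset.sum_preimage e F hinj.injOn _ hR0]
  calc _ = ∑ m ∈ F.preimage e hinj.injOn,
        (‖U (a (e m))‖ ^ p + ‖U (b (e m))‖ ^ p) * r ^ ((m : ℝ) * p) := by
        apply Finset.sum_congr rfl
        intro m _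
        have : monoR (Pi.single i0 r) (e m) = r ^ m := prod_single i0 r m
        rw [this, Real.rpow_natCast_mul hr]
    _ ≤ _ := hmain
    _ ≤ _ := mul_le_mul_of_nonneg_left
        (Real.rpow_le_rpow (supNormDisk_nonneg _) hle hp0.le) (Real.rpow_nonneg (by linarith) _)

lemma GoodR_of_GoodVec {n : ℕ} (hn : 0 < n) (U : (H →L[ℂ] H) →L[ℂ] Y) (p lam : ℝ) (hp : 1 ≤ p)
    (hlam : 1 ≤ lam) (q : ℝ≥0∞) (hq : 1 ≤ q) (r : Fin n → ℝ) (hr : ∀ i, 0 ≤ r i)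
    (hg : GoodVec (lqBall n q) p lam U (ClsPH (lqBall n q)) r) :
    GoodR p lam U ((n : ℝ) ^ (q⁻¹.toReal - 1) * (∑ i, r i ^ p) ^ (1 / p)) := by
  intro f a b hab hf F
  have hp0 : 0 < p := by linarith
  set c : ℝ := (n : ℝ) ^ (q⁻¹.toReal - 1) with hcdef
  have hc : 0 ≤ c := by positivity
  have hrp : 0 ≤ ∑ i, r i ^ p := Finset.sum_nonneg fun i _ => Real.rpow_nonneg (hr i) _
  have hlt : ∀ z ∈ lqBall n q, ‖(c : ℂ) * ∑ i, z i‖ < 1 := by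
    intro z hz
    refine lt_of_le_of_lt ?_ (sum_lt_of_mem hn q hq z hz)
    rw [norm_mul, Complex.norm_real, Real.norm_of_nonneg hc]
    exact mul_le_mul_of_nonneg_left (norm_sum_le _ _) hc
  set G : (Fin n → ℂ) → (H →L[ℂ] H) := fun z => f ((c : ℂ) * ∑ i, z i) with hG
  have hGb : IsBoundedOn (lqBall n q) G := by
    obtain ⟨M, hM⟩ := hf
    exact ⟨M, fun z hz => hM _ (hlt z hz)⟩
  have hGle : supNorm (lqBall n q) G ≤ supNormDisk f :=
    Real.iSup_le (fun z => le_supNormDisk hf (hlt _ z.2)) (supNormDisk_nonneg _)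
  have ha : ∀ z : ℂ, ‖z‖ < 1 → Summable (fun m => z ^ m • a m) := fun z hz => (hab.2 z hz).1
  have hb : ∀ z : ℂ, ‖z‖ < 1 →
      Summable (fun m => z ^ m • ContinuousLinearMap.adjoint (b m)) := by
    intro z hz
    have := (hab.2 (starRingEnd ℂ z) (by simpa using hz)).2.1
    simpa using this
  have hrep : Represents (lqBall n q) G (fun α => (kc c α : ℂ) • a (∑ i, α i))
      (fun α => (kc c α : ℂ) • b (∑ i, α i)) := by
    refine ⟨by simp [hab.1], fun z hz => ?_⟩
    have h1 := expand a ha c hc z (sum_lt_of_mem hn q hq z hz)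
    have h2 := expand (fun m => ContinuousLinearMap.adjoint (b m)) hb c hc (star z)
      (by simpa only [Pi.star_apply, norm_star] using sum_lt_of_mem hn q hq z hz)
    have hadj : ∀ α : Fin n → ℕ, ContinuousLinearMap.adjoint ((kc c α : ℂ) • b (∑ i, α i)) =
        (kc c α : ℂ) • ContinuousLinearMap.adjoint (b (∑ i, α i)) := by
      intro α
      rw [map_smulₛₗ]
      simp
    simp only [hadj]
    refine ⟨h1.1, h2.1, ?_⟩
    rw [h1.2, h2.2]
    change f _ = _
    rw [(hab.2 _ (hlt z hz)).2.2]
    simp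
  have hmain := hg G _ _ ⟨hrep, hGb⟩ (F.biUnion fun m => Finset.piAntidiag Finset.univ m)
  rw [Finset.sum_biUnion (by
    intro m _ m' _ hmm
    exact Finset.disjoint_left.2 fun α h1 h2 => hmm
      ((Finset.mem_piAntidiag.1 h1).1.symm.trans (Finset.mem_piAntidiag.1 h2).1))] at hmain
  have hpow : ∀ m : ℕ, (c * (∑ i, r i ^ p) ^ (1 / p)) ^ ((m : ℝ) * p) =
      (c ^ p * ∑ i, r i ^ p) ^ m := by
    intro m
    rw [mul_comm (m : ℝ) p, Real.rpow_mul (by positivity), Real.rpow_natCast,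
      Real.mul_rpow hc (by positivity), one_div, Real.rpow_inv_rpow hrp hp0.ne']
  refine le_trans (Finset.sum_le_sum ?_) (hmain.trans (mul_le_mul_of_nonneg_left
        (Real.rpow_le_rpow (supNorm_nonneg _ _) hGle hp0.le) (Real.rpow_nonneg (by linarith) _)))
  intro m _
  rw [hpow, ← sum_kcR, Finset.mul_sum]
  apply Finset.sum_le_sum
  intro α hα
  have hα' : ∑ i, α i = m := (Finset.mem_piAntidiag.1 hα).1
  rw [map_smul, map_smul, norm_smul, norm_smul, Complex.norm_real,
    Real.norm_of_nonneg (kc_nonneg hc α), Real.mul_rpow (kc_nonneg hc α) (norm_nonneg _),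
    Real.mul_rpow (kc_nonneg hc α) (norm_nonneg _), hα']
  have hmR : monoR (fun i => r i ^ p) α = monoR r α ^ p := by
    unfold monoR
    rw [← Real.finsetProd_rpow _ _ (fun i _ => pow_nonneg (hr i) _)]
    apply Finset.prod_congr rfl
    intro i _
    rw [← Real.rpow_mul_natCast (hr i), ← Real.rpow_natCast_mul (hr i), mul_comm]
  have hk : kc (c ^ p) α ≤ kc c α ^ p := by
    unfold kc
    rw [Real.mul_rpow (by positivity) (by positivity), ← Real.rpow_mul_natCast hc,
      ← Real.rpow_natCast_mul hc, mul_comm p]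
    apply mul_le_mul_of_nonneg_right _ (by positivity)
    apply Real.self_le_rpow_of_one_le _ hp
    exact_mod_cast Nat.multinomial_pos _ _
  rw [hmR]
  have hm0 : 0 ≤ monoR r α := Finset.prod_nonneg fun i _ => pow_nonneg (hr i) _
  calc _ ≤ (‖U (a m)‖ ^ p + ‖U (b m)‖ ^ p) * (monoR r α ^ p * kc c α ^ p) := by gcongr
    _ = _ := by ring

lemma mean_le {n : ℕ} (hn : 0 < n) (p : ℝ) (hp : 1 ≤ p) (s : ℝ) (r : Fin n → ℝ)
    (hr : ∀ i, 0 ≤ r i) :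
    (∑ i, r i) / n ≤ ((n : ℝ) ^ (s - 1) * (∑ i, r i ^ p) ^ (1 / p)) *
      (n : ℝ) ^ (-(1 / p + s - 1)) := by
  have hn' : (0 : ℝ) < n := by exact_mod_cast hn
  have hp0 : 0 < p := by linarith
  have key := Real.rpow_sum_le_const_mul_sum_rpow (Finset.univ) r hp
  simp only [abs_of_nonneg (hr _), Finset.card_univ, Fintype.card_fin] at key
  have hS : 0 ≤ ∑ i, r i := Finset.sum_nonneg fun i _ => hr i
  have hT : 0 ≤ ∑ i, r i ^ p := Finset.sum_nonneg fun i _ => Real.rpow_nonneg (hr i) _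
  have h2 := Real.rpow_le_rpow (by positivity) key (z := 1 / p) (by positivity)
  rw [one_div, Real.rpow_rpow_inv hS hp0.ne', Real.mul_rpow (by positivity) hT,
        ← Real.rpow_mul hn'.le] at h2
  rw [div_le_iff₀ hn', one_div]
  refine h2.trans (le_of_eq ?_)
  have : (n : ℝ) ^ ((p - 1) * p⁻¹) =
      (n : ℝ) ^ (s - 1) * (n : ℝ) ^ (-(p⁻¹ + s - 1)) * (n : ℝ) ^ (1 : ℝ) := by
    rw [← Real.rpow_add hn', ← Real.rpow_add hn']
    congr 1
    field_simp
    ring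
  rw [this, Real.rpow_one]
  ring

end Helpers


/-- Corollary `cor-1.5`:
`R_λ(𝔻,p,U)/n ≤ AP_λ(B_{ℓ^n_q},p,U) ≤ R_λ(𝔻,p,U)/n^{1/p+1/q-1}`. -/
theorem statement13
    {H : Type*} [NormedAddCommGroup H] [InnerProductSpace ℂ H] [CompleteSpace H]
    {Y : Type*} [NormedAddCommGroup Y] [NormedSpace ℂ Y] [CompleteSpace Y]
    (U : (H →L[ℂ] H) →L[ℂ] Y) (hU : U ≠ 0)
    (p lam : ℝ) (hp : 1 ≤ p) (hlam : 1 ≤ lam) (hUlam : ‖U‖ < lam)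
    (q : ℝ≥0∞) (hq : 1 ≤ q) :
    ∀ n : ℕ, 0 < n →
      BohrRadiusDisk p lam U / n ≤ APradius (lqBall n q) p lam U ∧
        APradius (lqBall n q) p lam U ≤
          BohrRadiusDisk p lam U * (n : ℝ) ^ (-(1 / p + q⁻¹.toReal - 1)) := by
  intro n hn
  have hn' : (0 : ℝ) < n := by exact_mod_cast hn
  have hR : BohrRadiusDisk p lam U = sSup {r : ℝ | 0 ≤ r ∧ GoodR p lam U r} := rfl
  have hbdd := GoodR_bdd U hU p lam hp hlam
  have hne : {r : ℝ | 0 ≤ r ∧ GoodR p lam U r}.Nonempty :=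
    ⟨0, le_refl _, GoodR_zero U p lam hp hUlam⟩
  have hRnn : 0 ≤ BohrRadiusDisk p lam U := Real.sSup_nonneg fun r hr => hr.1
  have hub : ∀ t ∈ {t : ℝ | ∃ r : Fin n → ℝ, (∀ i, 0 ≤ r i) ∧
      GoodVec (lqBall n q) p lam U (ClsPH (lqBall n q)) r ∧ t = (∑ i, r i) / n},
      t ≤ BohrRadiusDisk p lam U * (n : ℝ) ^ (-(1 / p + q⁻¹.toReal - 1)) := by
    rintro t ⟨r, hr, hg, rfl⟩
    refine (mean_le hn p hp q⁻¹.toReal r hr).trans ?_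
    apply mul_le_mul_of_nonneg_right _ (by positivity)
    rw [hR]
    refine le_csSup hbdd ⟨?_, GoodR_of_GoodVec hn U p lam hp hlam q hq r hr hg⟩
    exact mul_nonneg (by positivity)
      (Real.rpow_nonneg (Finset.sum_nonneg fun i _ => Real.rpow_nonneg (hr i) _) _)
  constructor
  · rw [div_le_iff₀ hn', hR]
    apply csSup_le hne
    rintro r ⟨hr, hg⟩
    rw [← div_le_iff₀ hn']
    refine le_csSup ⟨_, hub⟩ ⟨Pi.single ⟨0, hn⟩ r, ?_,
      GoodVec_single U p lam hp hlam q hq ⟨0, hn⟩ r hr hg, ?_⟩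
    · intro i
      by_cases hi : i = ⟨0, hn⟩
      · subst hi; simpa using hr
      · simp [hi]
    · simp
  · exact Real.sSup_le hub (by positivity)

end ArithBohr
end
end
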